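/- Let n ≥ 4 and let (W,S) be a Coxeter system of type Dₙ, i.e., with simple reflections s₁,…,sₙ where the order of s_i s_{i+1} is 3 for 2 ≤ i ≤ n−1, the order of s₁ s₃ is 3, and all other pairs of distinct simple reflections commute, with W finite. Then the number of maximal chains in the noncrossing partition lattice L_W equals 2·(n−1)ⁿ. -/

import Mathlib

open scoped BigOperators

section Defs

variable {G : Type*} [Group G]

/-- `t` is a reflection with respect to the generating set `S`:
a conjugate of an element of `S`. -/
def IsReflectionOf (S : Set G) (t : G) : Prop :=
  ∃ g : G, ∃ s ∈ S, t = g * s * g⁻¹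

/-- The absolute length of `w`: the minimal length of a word in the
reflections (conjugates of elements of `S`) whose product is `w`. -/
noncomputable def absLength (S : Set G) (w : G) : ℕ :=
  sInf {k | ∃ l : List G, (∀ t ∈ l, IsReflectionOf S t) ∧ l.length = k ∧ l.prod = w}

/-- The absolute order: `u ≤ v` iff `ℓ_T(u) + ℓ_T(u⁻¹v) = ℓ_T(v)`. -/
def absLe (S : Set G) (u v : G) : Prop :=
  absLength S u + absLength S (u⁻¹ * v) = absLength S v

/-- `c` is a Coxeter element with respect to the set `S` of simple reflections:
a product of all the elements of `S`, each occurring exactly once, in some order. -/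
def IsCoxeterElementOf (S : Set G) (c : G) : Prop :=
  ∃ l : List G, l.Nodup ∧ (∀ x, x ∈ l ↔ x ∈ S) ∧ l.prod = c

/-- The rank-selected multichain count `C_{(j₁,…,j_m)}(W)`: the number of multichains
`x₁ ≤ ⋯ ≤ x_{m-1}` in the interval `[1,c]` of the absolute order whose sequence of
rank jumps (prepending `1` and appending `c`) is given by `j`. -/
noncomputable def chainCount (S : Set G) (c : G) {m : ℕ} (j : Fin m → ℕ) : ℕ :=
  Nat.card {y : Fin (m + 1) → G //
    y 0 = 1 ∧ y (Fin.last m) = c ∧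
    (∀ i, absLe S (y i) c) ∧
    (∀ i : Fin m, absLe S (y i.castSucc) (y i.succ)) ∧
    (∀ i : Fin m, absLength S (y i.succ) = absLength S (y i.castSucc) + j i)}

end Defs

section Cox

variable {B : Type*} {W : Type*} [Group W] {M : CoxeterMatrix B}

/-- The set of simple reflections of a Coxeter system. -/
def simpleSet (cs : CoxeterSystem M W) : Set W := Set.range cs.simple

/-- A Coxeter system is irreducible if its set of simple reflections is nonempty and cannot
be partitioned into two nonempty subsets such that every simple reflection in one commutes
with every simple reflection in the other. -/
def IsIrreducibleCS (cs : CoxeterSystem M W) : Prop :=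
  Nonempty B ∧
    ∀ A : Set B, (∀ a ∈ A, ∀ b ∈ Aᶜ, Commute (cs.simple a) (cs.simple b)) →
      A = ∅ ∨ A = Set.univ

/-- The standard parabolic subgroup `W_⟨s⟩` generated by the simple reflections
other than `cs.simple s`. -/
def parabolic (cs : CoxeterSystem M W) (s : B) : Subgroup W :=
  Subgroup.closure (Set.range cs.simple \ {cs.simple s})

/-- The set of simple reflections of the parabolic subgroup `W_⟨s⟩`, viewed as
elements of that subgroup. -/
def parabolicGens (cs : CoxeterSystem M W) (s : B) : Set (parabolic cs s) :=
  {x | (x : W) ∈ Set.range cs.simple \ {cs.simple s}}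

end Cox

section MaxChains

variable {G : Type*} [Group G]

/-- The number of maximal chains `1 = x₀ < x₁ < ⋯ < x_n = c` (with `ℓ_T(x_i) = i` for
all `i`) in the noncrossing partition lattice `[1,c]` in the absolute order. -/
noncomputable def maxChainCount (S : Set G) (c : G) (n : ℕ) : ℕ :=
  Nat.card {y : Fin (n + 1) → G //
    y 0 = 1 ∧ y (Fin.last n) = c ∧
    (∀ i : Fin n, absLe S (y i.castSucc) (y i.succ)) ∧
    (∀ i : Fin (n + 1), absLength S (y i) = (i : ℕ))}

end MaxChains

namespace SignedPerm

open Module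
open Finset.HasAntidiagonal (antidiagonal mem_antidiagonal)

variable {ι κ : Type} [Fintype ι] [DecidableEq ι] [Fintype κ] [DecidableEq κ]

/-- The orthogonal reflection exchanging `e i` and `ε • e j`, acting on functions. -/
def refl (i j : ι) (ε : ℤˣ) : Module.End ℚ (ι → ℚ) where
  toFun f x := if x = i then ((ε : ℤ) : ℚ) * f j else if x = j then ((ε : ℤ) : ℚ) * f i else f x
  map_add' f g := by
    funext x
    simp only [Pi.add_apply]
    split_ifs <;> ring
  map_smul' a f := by
    funext x
    simp only [Pi.smul_apply, smul_eq_mul, RingHom.id_apply]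
    split_ifs <;> ring

omit [Fintype ι] in
theorem refl_apply (i j : ι) (ε : ℤˣ) (f : ι → ℚ) (x : ι) :
    refl i j ε f x =
      if x = i then ((ε : ℤ) : ℚ) * f j else if x = j then ((ε : ℤ) : ℚ) * f i else f x := rfl

theorem sign_mul_self (ε : ℤˣ) : ((ε : ℤ) : ℚ) * ((ε : ℤ) : ℚ) = 1 := by
  rcases Int.units_eq_one_or ε with rfl | rfl <;> simp

open Classical in
/-- The number of ways to write `w` as a product of `k` reflections `refl i j ε`;
the factor `1 / 2` accounts for `refl i j ε = refl j i ε`. -/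
noncomputable def factCount (ι : Type) [Fintype ι] [DecidableEq ι] :
    ℕ → Module.End ℚ (ι → ℚ) → ℚ
  | 0, w => if w = 1 then 1 else 0
  | k + 1, w => 1 / 2 * ∑ i, ∑ j, ∑ ε : ℤˣ,
      if i = j then 0 else factCount ι k (w * refl i j ε)

/-- The subspace of vectors fixed by `w`. -/
def fixed (w : Module.End ℚ (ι → ℚ)) : Submodule ℚ (ι → ℚ) := LinearMap.eqLocus w 1

omit [Fintype ι] [DecidableEq ι] in
theorem mem_fixed {w : Module.End ℚ (ι → ℚ)} {f : ι → ℚ} : f ∈ fixed w ↔ w f = f := Iff.rfl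

theorem card_le_finrank_fixed_refl (i j : ι) (ε : ℤˣ) :
    Fintype.card ι ≤ finrank ℚ (fixed (refl i j ε)) + 1 := by
  let l : (ι → ℚ) →ₗ[ℚ] ℚ := LinearMap.proj i - ((ε : ℤ) : ℚ) • LinearMap.proj j
  have h1 := LinearMap.finrank_range_add_finrank_ker l
  have h2 : finrank ℚ (LinearMap.range l) ≤ 1 := by
    simpa using Submodule.finrank_le (LinearMap.range l)
  have h3 : LinearMap.ker l ≤ fixed (refl i j ε) := by
    intro f hf
    have hf' : f i = ((ε : ℤ) : ℚ) * f j := by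
      have : f i - ((ε : ℤ) : ℚ) * f j = 0 := hf
      linarith
    rw [mem_fixed]
    funext x
    rw [refl_apply]
    split_ifs with h h'
    · rw [h, hf']
    · rw [h', hf', ← mul_assoc, sign_mul_self, one_mul]
    · rfl
  have h4 := Submodule.finrank_mono h3
  simp only [Module.finrank_fintype_fun_eq_card] at h1
  omega

omit [Fintype ι] [DecidableEq ι] in
theorem fixed_mul_inf_le (w t : Module.End ℚ (ι → ℚ)) : fixed (w * t) ⊓ fixed t ≤ fixed w := by
  rintro f ⟨h1, h2⟩
  have h1' : w (t f) = f := h1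
  have h2' : t f = f := h2
  rw [h2'] at h1'
  exact h1'

theorem finrank_fixed_mul_le_inf (w : Module.End ℚ (ι → ℚ)) (i j : ι) (ε : ℤˣ) :
    finrank ℚ (fixed (w * refl i j ε)) ≤
      finrank ℚ (fixed (w * refl i j ε) ⊓ fixed (refl i j ε) : Submodule ℚ (ι → ℚ)) + 1 := by
  have h1 := card_le_finrank_fixed_refl i j ε
  have h2 := Submodule.finrank_sup_add_finrank_inf_eq (fixed (w * refl i j ε)) (fixed (refl i j ε))
  have h3 := Submodule.finrank_le (fixed (w * refl i j ε) ⊔ fixed (refl i j ε))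
  simp only [Module.finrank_fintype_fun_eq_card] at h3
  omega

theorem finrank_fixed_mul_le (w : Module.End ℚ (ι → ℚ)) (i j : ι) (ε : ℤˣ) :
    finrank ℚ (fixed (w * refl i j ε)) ≤ finrank ℚ (fixed w) + 1 :=
  (finrank_fixed_mul_le_inf w i j ε).trans
    (Nat.succ_le_succ (Submodule.finrank_mono (fixed_mul_inf_le w _)))

/-- A product of `k` reflections fixes a subspace of codimension at most `k`. -/
theorem card_le_of_factCount_ne_zero (k : ℕ) (w : Module.End ℚ (ι → ℚ))
    (h : factCount ι k w ≠ 0) : Fintype.card ι ≤ k + finrank ℚ (fixed w) := by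
  induction k generalizing w with
  | zero =>
    have hw : w = 1 := by
      by_contra hw
      exact h (by simp [factCount, hw])
    have : fixed w = ⊤ := by
      rw [hw, eq_top_iff]
      intro f _
      rfl
    rw [this]
    simp
  | succ k ih =>
    have : ∃ i j, ∃ ε : ℤˣ, factCount ι k (w * refl i j ε) ≠ 0 := by
      by_contra! hcon
      apply h
      rw [factCount]
      simp only [mul_eq_zero]
      right
      refine Finset.sum_eq_zero fun i _ => Finset.sum_eq_zero fun j _ =>
        Finset.sum_eq_zero fun ε _ => ?_
      split_ifs with hij
      · rfl
      · exact hcon i j ε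
    obtain ⟨i, j, ε, hne⟩ := this
    have := ih _ hne
    have := finrank_fixed_mul_le w i j ε
    omega

/-- In a minimal factorization, every reflection fixes the vectors fixed by the product. -/
theorem fixed_le_fixed_refl {k : ℕ} {w : Module.End ℚ (ι → ℚ)}
    (hk : k + 1 + finrank ℚ (fixed w) ≤ Fintype.card ι) {i j : ι} {ε : ℤˣ}
    (h : factCount ι k (w * refl i j ε) ≠ 0) : fixed w ≤ fixed (refl i j ε) := by
  have h1 := card_le_of_factCount_ne_zero k _ h
  have h2 := finrank_fixed_mul_le_inf w i j ε
  have h3 := fixed_mul_inf_le w (refl i j ε)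
  have h4 := Submodule.eq_of_le_of_finrank_le h3 (by omega)
  rw [← h4]
  exact inf_le_right

/-- The signed reindexing of coordinates along `σ`. -/
def reindex (σ : κ ≃ ι) (η : κ → ℤˣ) : (ι → ℚ) →ₗ[ℚ] (κ → ℚ) where
  toFun f x := ((η x : ℤ) : ℚ) * f (σ x)
  map_add' f g := by
    funext x
    simp only [Pi.add_apply]
    ring
  map_smul' a f := by
    funext x
    simp only [Pi.smul_apply, smul_eq_mul, RingHom.id_apply]
    ring

omit [Fintype ι] [DecidableEq ι] [Fintype κ] [DecidableEq κ] in
theorem reindex_apply (σ : κ ≃ ι) (η : κ → ℤˣ) (f : ι → ℚ) (x : κ) :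
    reindex σ η f x = ((η x : ℤ) : ℚ) * f (σ x) := rfl

omit [Fintype ι] [DecidableEq ι] [Fintype κ] [DecidableEq κ] in
theorem reindex_injective (σ : κ ≃ ι) (η : κ → ℤˣ) : Function.Injective (reindex σ η) := by
  intro f g h
  funext x
  have := congrFun h (σ.symm x)
  simp only [reindex_apply, Equiv.apply_symm_apply] at this
  have h2 := congrArg (fun q => ((η (σ.symm x) : ℤ) : ℚ) * q) this
  simpa [← mul_assoc, sign_mul_self] using h2

omit [Fintype ι] [DecidableEq ι] [Fintype κ] [DecidableEq κ] in
theorem reindex_surjective (σ : κ ≃ ι) (η : κ → ℤˣ) : Function.Surjective (reindex σ η) := by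
  intro g
  refine ⟨fun x => ((η (σ.symm x) : ℤ) : ℚ) * g (σ.symm x), ?_⟩
  funext x
  simp [reindex_apply, ← mul_assoc, sign_mul_self]

omit [Fintype ι] [Fintype κ] in
theorem reindex_refl (σ : κ ≃ ι) (η : κ → ℤˣ) (i j : κ) (ε : ℤˣ) (f : ι → ℚ) :
    reindex σ η (refl (σ i) (σ j) (η i * η j * ε) f) = refl i j ε (reindex σ η f) := by
  funext x
  simp only [reindex_apply, refl_apply, EmbeddingLike.apply_eq_iff_eq, Units.val_mul, Int.cast_mul]
  have h1 := sign_mul_self (η i)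
  have h2 := sign_mul_self (η j)
  split_ifs with h h'
  · subst h
    linear_combination ((η j : ℤ) : ℚ) * ε * f (σ j) * h1
  · subst h'
    linear_combination ((η i : ℤ) : ℚ) * ε * f (σ i) * h2
  · rfl

/-- `factCount` is invariant under signed reindexing. -/
theorem factCount_reindex (σ : κ ≃ ι) (η : κ → ℤˣ) (k : ℕ) (w : Module.End ℚ (ι → ℚ))
    (w' : Module.End ℚ (κ → ℚ)) (h : ∀ f, reindex σ η (w f) = w' (reindex σ η f)) :
    factCount κ k w' = factCount ι k w := by
  induction k generalizing w w' with
  | zero =>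
    have : w' = 1 ↔ w = 1 := by
      constructor
      · rintro rfl
        ext1 f
        exact LinearMap.ext fun q => reindex_injective σ η (h _)
      · rintro rfl
        apply LinearMap.ext
        intro g
        obtain ⟨f, rfl⟩ := reindex_surjective σ η g
        exact (h f).symm
    by_cases hw : w = 1 <;> simp [factCount, this, hw]
  | succ k ih =>
    simp only [factCount]
    congr 1
    rw [← Equiv.sum_comp σ]
    refine Finset.sum_congr rfl fun i _ => ?_
    rw [← Equiv.sum_comp σ]
    refine Finset.sum_congr rfl fun j _ => ?_
    rw [← Equiv.sum_comp (Equiv.mulLeft (η i * η j))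
      (fun ε => if σ i = σ j then 0 else factCount ι k (w * refl (σ i) (σ j) ε))]
    refine Finset.sum_congr rfl fun ε _ => ?_
    simp only [EmbeddingLike.apply_eq_iff_eq, Equiv.coe_mulLeft]
    split_ifs
    · rfl
    · refine ih _ _ fun f => ?_
      rw [Module.End.mul_apply, Module.End.mul_apply, h, reindex_refl]

/-- The block sum of two endomorphisms. -/
def blockSum (u : Module.End ℚ (ι → ℚ)) (v : Module.End ℚ (κ → ℚ)) :
    Module.End ℚ (ι ⊕ κ → ℚ) where
  toFun f := Sum.elim (u fun x => f (Sum.inl x)) (v fun x => f (Sum.inr x))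
  map_add' f g := by
    funext x
    rcases x with x | x
    · exact congrFun (u.map_add (fun x => f (Sum.inl x)) (fun x => g (Sum.inl x))) x
    · exact congrFun (v.map_add (fun x => f (Sum.inr x)) (fun x => g (Sum.inr x))) x
  map_smul' a f := by
    funext x
    rcases x with x | x
    · exact congrFun (u.map_smul a (fun x => f (Sum.inl x))) x
    · exact congrFun (v.map_smul a (fun x => f (Sum.inr x))) x

omit [Fintype ι] [DecidableEq ι] [Fintype κ] [DecidableEq κ] in
theorem blockSum_apply_inl (u : Module.End ℚ (ι → ℚ)) (v : Module.End ℚ (κ → ℚ))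
    (f : ι ⊕ κ → ℚ) (x : ι) : blockSum u v f (Sum.inl x) = u (fun x => f (Sum.inl x)) x := rfl

omit [Fintype ι] [DecidableEq ι] [Fintype κ] [DecidableEq κ] in
theorem blockSum_apply_inr (u : Module.End ℚ (ι → ℚ)) (v : Module.End ℚ (κ → ℚ))
    (f : ι ⊕ κ → ℚ) (x : κ) : blockSum u v f (Sum.inr x) = v (fun x => f (Sum.inr x)) x := rfl

omit [Fintype ι] [Fintype κ] in
theorem blockSum_mul_refl_inl (u : Module.End ℚ (ι → ℚ)) (v : Module.End ℚ (κ → ℚ))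
    (i j : ι) (ε : ℤˣ) :
    blockSum u v * refl (Sum.inl i) (Sum.inl j) ε = blockSum (u * refl i j ε) v := by
  apply LinearMap.ext
  intro f
  funext x
  rcases x with x | x
  · simp only [Module.End.mul_apply, blockSum_apply_inl]
    refine congrFun (congrArg _ (funext fun y => ?_)) x
    simp [refl_apply]
  · simp only [Module.End.mul_apply, blockSum_apply_inr]
    simp [refl_apply]

omit [Fintype ι] [Fintype κ] in
theorem blockSum_mul_refl_inr (u : Module.End ℚ (ι → ℚ)) (v : Module.End ℚ (κ → ℚ))
    (i j : κ) (ε : ℤˣ) :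
    blockSum u v * refl (Sum.inr i) (Sum.inr j) ε = blockSum u (v * refl i j ε) := by
  apply LinearMap.ext
  intro f
  funext x
  rcases x with x | x
  · simp only [Module.End.mul_apply, blockSum_apply_inl]
    simp [refl_apply]
  · simp only [Module.End.mul_apply, blockSum_apply_inr]
    refine congrFun (congrArg _ (funext fun y => ?_)) x
    simp [refl_apply]

omit [Fintype ι] [DecidableEq ι] [Fintype κ] [DecidableEq κ] in
theorem mem_fixed_blockSum {u : Module.End ℚ (ι → ℚ)} {v : Module.End ℚ (κ → ℚ)}
    {f : ι ⊕ κ → ℚ} : f ∈ fixed (blockSum u v) ↔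
      (fun x => f (Sum.inl x)) ∈ fixed u ∧ (fun x => f (Sum.inr x)) ∈ fixed v := by
  simp only [mem_fixed, funext_iff, Sum.forall, blockSum_apply_inl, blockSum_apply_inr]

omit [DecidableEq ι] [DecidableEq κ] in
theorem finrank_fixed_blockSum_le (u : Module.End ℚ (ι → ℚ)) (v : Module.End ℚ (κ → ℚ)) :
    finrank ℚ (fixed (blockSum u v)) ≤ finrank ℚ (fixed u) + finrank ℚ (fixed v) := by
  rw [← Module.finrank_prod]
  let φ : fixed (blockSum u v) →ₗ[ℚ] fixed u × fixed v :=
    { toFun := fun f => (⟨_, (mem_fixed_blockSum.1 f.2).1⟩, ⟨_, (mem_fixed_blockSum.1 f.2).2⟩)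
      map_add' := fun _ _ => rfl
      map_smul' := fun _ _ => rfl }
  refine LinearMap.finrank_le_finrank_of_injective (f := φ) ?_
  intro f g h
  have h1 := congrArg (fun p => (p.1 : ι → ℚ)) h
  have h2 := congrArg (fun p => (p.2 : κ → ℚ)) h
  apply Subtype.ext
  funext x
  rcases x with x | x
  · exact congrFun h1 x
  · exact congrFun h2 x

omit [Fintype ι] [DecidableEq ι] [Fintype κ] [DecidableEq κ] in
theorem blockSum_eq_one_iff {u : Module.End ℚ (ι → ℚ)} {v : Module.End ℚ (κ → ℚ)} :
    blockSum u v = 1 ↔ u = 1 ∧ v = 1 := by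
  constructor
  · intro h
    constructor
    · refine LinearMap.ext fun f => funext fun x => ?_
      have := congrFun (LinearMap.congr_fun h (Sum.elim f 0)) (Sum.inl x)
      exact this
    · refine LinearMap.ext fun f => funext fun x => ?_
      have := congrFun (LinearMap.congr_fun h (Sum.elim 0 f)) (Sum.inr x)
      exact this
  · rintro ⟨rfl, rfl⟩
    refine LinearMap.ext fun f => funext fun x => ?_
    rcases x with x | x <;> rfl

/-- Shuffle formula for minimal factorizations of a block sum. -/
theorem factCount_blockSum (k : ℕ) (u : Module.End ℚ (ι → ℚ)) (v : Module.End ℚ (κ → ℚ))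
    (hu : (fun _ => 1) ∈ fixed u)
    (hk : k + (finrank ℚ (fixed u) + finrank ℚ (fixed v)) ≤ Fintype.card ι + Fintype.card κ) :
    factCount (ι ⊕ κ) k (blockSum u v) =
      ∑ p ∈ antidiagonal k, (k.choose p.1 : ℚ) * (factCount ι p.1 u * factCount κ p.2 v) := by
  induction k generalizing u v with
  | zero =>
    by_cases h1 : u = 1 <;> by_cases h2 : v = 1 <;> simp [factCount, blockSum_eq_one_iff, h1, h2]
  | succ k ih =>
    have hF := finrank_fixed_blockSum_le u v
    have hmem : Sum.elim (fun _ => 1) 0 ∈ fixed (blockSum u v) := by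
      rw [mem_fixed_blockSum]
      exact ⟨hu, (fixed v).zero_mem⟩
    have key : ∀ (i j : ι ⊕ κ) (ε : ℤˣ),
        refl i j ε (Sum.elim (fun _ => 1) 0) ≠ Sum.elim (fun _ => 1) 0 →
        factCount (ι ⊕ κ) k (blockSum u v * refl i j ε) = 0 := by
      intro i j ε hne
      by_contra hcon
      refine hne (fixed_le_fixed_refl ?_ hcon hmem)
      rw [Fintype.card_sum]
      omega
    have cross1 : ∀ (i : ι) (j : κ) (ε : ℤˣ),
        factCount (ι ⊕ κ) k (blockSum u v * refl (Sum.inl i) (Sum.inr j) ε) = 0 := by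
      intro i j ε
      refine key _ _ _ fun h => ?_
      simpa [refl_apply] using congrFun h (Sum.inl i)
    have cross2 : ∀ (i : κ) (j : ι) (ε : ℤˣ),
        factCount (ι ⊕ κ) k (blockSum u v * refl (Sum.inr i) (Sum.inl j) ε) = 0 := by
      intro i j ε
      refine key _ _ _ fun h => ?_
      simpa [refl_apply] using congrFun h (Sum.inl j)
    have left : ∀ (i j : ι) (ε : ℤˣ),
        factCount (ι ⊕ κ) k (blockSum u v * refl (Sum.inl i) (Sum.inl j) ε) =
          ∑ p ∈ antidiagonal k, (k.choose p.1 : ℚ) *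
            (factCount ι p.1 (u * refl i j ε) * factCount κ p.2 v) := by
      intro i j ε
      rcases Int.units_eq_one_or ε with rfl | rfl
      · rw [blockSum_mul_refl_inl]
        refine ih _ _ ?_ ?_
        · have h1 : refl i j 1 (fun _ => 1) = fun _ => 1 := by
            funext x
            simp [refl_apply]
          rw [mem_fixed, Module.End.mul_apply, h1, mem_fixed.1 hu]
        · have := finrank_fixed_mul_le u i j 1
          omega
      · rw [key]
        · symm
          refine Finset.sum_eq_zero fun p hp => ?_
          rw [mem_antidiagonal] at hp
          by_contra hcon
          have h1 : factCount ι p.1 (u * refl i j (-1)) ≠ 0 := fun h => hcon (by simp [h])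
          have h2 : factCount κ p.2 v ≠ 0 := fun h => hcon (by simp [h])
          have h3 := card_le_of_factCount_ne_zero _ _ h2
          have h4 := fixed_le_fixed_refl (by omega) h1 hu
          have h5 := congrFun (mem_fixed.1 h4) i
          norm_num [refl_apply] at h5
        · intro h
          have h5 := congrFun h (Sum.inl i)
          norm_num [refl_apply] at h5
    have right : ∀ (i j : κ) (ε : ℤˣ),
        factCount (ι ⊕ κ) k (blockSum u v * refl (Sum.inr i) (Sum.inr j) ε) =
          ∑ p ∈ antidiagonal k, (k.choose p.1 : ℚ) *
            (factCount ι p.1 u * factCount κ p.2 (v * refl i j ε)) := by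
      intro i j ε
      rw [blockSum_mul_refl_inr]
      refine ih _ _ hu ?_
      have := finrank_fixed_mul_le v i j ε
      omega
    rw [Finset.sum_antidiagonal_choose_succ_mul
      (fun a b => factCount ι a u * factCount κ b v)]
    have e1 : ∀ a, factCount ι (a + 1) u = 1 / 2 * ∑ i, ∑ j, ∑ ε : ℤˣ,
        if i = j then 0 else factCount ι a (u * refl i j ε) := fun _ => rfl
    have e2 : ∀ a, factCount κ (a + 1) v = 1 / 2 * ∑ i, ∑ j, ∑ ε : ℤˣ,
        if i = j then 0 else factCount κ a (v * refl i j ε) := fun _ => rfl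
    have e3 : factCount (ι ⊕ κ) (k + 1) (blockSum u v) = 1 / 2 * ∑ i, ∑ j, ∑ ε : ℤˣ,
        if i = j then 0 else factCount (ι ⊕ κ) k (blockSum u v * refl i j ε) := rfl
    have swap_ite : ∀ (P : Prop) [Decidable P] (g : ℕ × ℕ → ℚ),
        (if P then 0 else ∑ p ∈ antidiagonal k, g p) =
          ∑ p ∈ antidiagonal k, if P then 0 else g p := by
      intro P _ g
      split_ifs <;> simp
    have sum_right : (∑ i : κ, ∑ j, ∑ ε : ℤˣ, if i = j then 0 else
        ∑ p ∈ antidiagonal k, (k.choose p.1 : ℚ) *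
            (factCount ι p.1 u * factCount κ p.2 (v * refl i j ε))) =
        2 * ∑ p ∈ antidiagonal k, (k.choose p.1 : ℚ) *
            (factCount ι p.1 u * factCount κ (p.2 + 1) v) := by
      simp only [swap_ite, e2, Finset.mul_sum, Finset.sum_comm (s := Finset.univ)
        (t := antidiagonal k)]
      refine Finset.sum_congr rfl fun p _ => Finset.sum_congr rfl fun i _ =>
        Finset.sum_congr rfl fun j _ => Finset.sum_congr rfl fun ε _ => ?_
      split_ifs <;> ring
    have sum_left : (∑ i : ι, ∑ j, ∑ ε : ℤˣ, if i = j then 0 else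
        ∑ p ∈ antidiagonal k, (k.choose p.1 : ℚ) *
            (factCount ι p.1 (u * refl i j ε) * factCount κ p.2 v)) =
        2 * ∑ p ∈ antidiagonal k, (k.choose p.2 : ℚ) *
            (factCount ι (p.1 + 1) u * factCount κ p.2 v) := by
      simp only [swap_ite, e1, Finset.mul_sum, Finset.sum_mul, Finset.sum_comm (s := Finset.univ)
        (t := antidiagonal k)]
      refine Finset.sum_congr rfl fun p hp => Finset.sum_congr rfl fun i _ =>
        Finset.sum_congr rfl fun j _ => Finset.sum_congr rfl fun ε _ => ?_
      rw [Nat.choose_symm_of_eq_add (mem_antidiagonal.1 hp).symm]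
      split_ifs <;> ring
    rw [e3]
    simp only [Fintype.sum_sum_type, left, right, cross1, cross2, Sum.inl.injEq, Sum.inr.injEq,
      reduceCtorEq, if_false, Finset.sum_const_zero, add_zero, zero_add]
    rw [sum_left, sum_right]
    ring

/-- A block sum of two elements of reflection length `a` and `b`, the first of which fixes
the all-ones vector, has `(a + b).choose a` shuffles per pair of factorizations. -/
theorem factCount_blockSum_of_card_eq (a b : ℕ) (u : Module.End ℚ (ι → ℚ))
    (v : Module.End ℚ (κ → ℚ)) (hu : (fun _ => 1) ∈ fixed u)
    (ha : a + finrank ℚ (fixed u) = Fintype.card ι)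
    (hb : b + finrank ℚ (fixed v) = Fintype.card κ) :
    factCount (ι ⊕ κ) (a + b) (blockSum u v) =
      ((a + b).choose a : ℚ) * (factCount ι a u * factCount κ b v) := by
  rw [factCount_blockSum _ _ _ hu (by omega)]
  rw [Finset.sum_eq_single (a, b)]
  · intro p hp hne
    rw [mem_antidiagonal] at hp
    by_contra hcon
    have h1 : factCount ι p.1 u ≠ 0 := fun h => hcon (by simp [h])
    have h2 : factCount κ p.2 v ≠ 0 := fun h => hcon (by simp [h])
    have h3 := card_le_of_factCount_ne_zero _ _ h1
    have h4 := card_le_of_factCount_ne_zero _ _ h2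
    exact hne (Prod.ext (by omega) (by omega))
  · intro h
    exact absurd (mem_antidiagonal.2 (rfl : (a, b).1 + (a, b).2 = a + b)) h

end SignedPerm

namespace SignedPerm
open Module
open Finset.HasAntidiagonal (antidiagonal mem_antidiagonal)

open Polynomial in
/-- Abel's binomial identity at `x = 1`, as an identity of polynomials. -/
theorem abel_polynomial (n : ℕ) :
    ∑ k ∈ Finset.range (n + 1),
      C ((n.choose k : ℚ) * ((k : ℚ) + 1) ^ (k - 1)) * (X - C (k : ℚ)) ^ (n - k) =
      (X + 1 : ℚ[X]) ^ n := by
  induction n with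
  | zero => simp
  | succ n ih =>
    have hder : derivative (∑ k ∈ Finset.range (n + 1 + 1),
        C (((n + 1).choose k : ℚ) * ((k : ℚ) + 1) ^ (k - 1)) * (X - C (k : ℚ)) ^ (n + 1 - k)) =
        derivative ((X + 1 : ℚ[X]) ^ (n + 1)) := by
      rw [Finset.sum_range_succ, derivative_add, derivative_sum]
      have h1 : derivative ((X + 1 : ℚ[X]) ^ (n + 1)) = C ((n : ℚ) + 1) * (X + 1) ^ n := by
        simp [derivative_pow]
      rw [h1, ← ih, Finset.mul_sum]
      simp only [Nat.sub_self, pow_zero, mul_one, derivative_C, add_zero]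
      refine Finset.sum_congr rfl fun k hk => ?_
      have hk' : k ≤ n := Nat.lt_succ_iff.1 (Finset.mem_range.1 hk)
      rw [derivative_C_mul, derivative_X_sub_C_pow, Nat.succ_sub hk', Nat.succ_sub_one]
      rw [← mul_assoc, ← mul_assoc, ← C_mul, ← C_mul]
      congr 2
      have h2 : (n + 1).choose k * (n - k).succ = (n + 1) * n.choose k := by
        have := Nat.choose_mul_succ_eq n k
        rw [Nat.succ_eq_add_one, show n - k + 1 = n + 1 - k by omega, ← this, mul_comm]
      have h3 : ((n + 1).choose k : ℚ) * ((n - k).succ : ℕ) = (n + 1) * n.choose k := by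
        exact_mod_cast h2
      linear_combination ((k : ℚ) + 1) ^ (k - 1) * h3
    have heval : eval (-1) (∑ k ∈ Finset.range (n + 1 + 1),
        C (((n + 1).choose k : ℚ) * ((k : ℚ) + 1) ^ (k - 1)) * (X - C (k : ℚ)) ^ (n + 1 - k)) =
        eval (-1) ((X + 1 : ℚ[X]) ^ (n + 1)) := by
      have h1 := congrFun (fwdDiff_iter_pow_eq_zero_of_lt (R := ℚ) (Nat.lt_succ_self n)) 1
      rw [fwdDiff_iter_eq_sum_shift] at h1
      simp only [eval_finsetSum, eval_mul, eval_C, eval_pow, eval_sub, eval_X, eval_add, eval_one,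
        neg_add_cancel, zero_pow (Nat.succ_ne_zero n)]
      rw [Pi.zero_apply] at h1
      rw [← h1]
      refine Finset.sum_congr rfl fun k hk => ?_
      have hk' : k ≤ n + 1 := Nat.lt_succ_iff.1 (Finset.mem_range.1 hk)
      have h2 : (-1 - (k : ℚ)) ^ (n + 1 - k) = (-1) ^ (n + 1 - k) * (k + 1) ^ (n + 1 - k) := by
        rw [← mul_pow]
        congr 1
        ring
      have h3 : ((k : ℚ) + 1) ^ (k - 1) * ((k : ℚ) + 1) ^ (n + 1 - k) = (1 + k) ^ n := by
        rcases k with _ | k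
        · simp
        · rw [← pow_add, show k + 1 - 1 + (n + 1 - (k + 1)) = n by omega, add_comm]
      rw [h2, zsmul_eq_mul]
      push_cast
      rw [nsmul_eq_mul, mul_one, Nat.succ_eq_add_one]
      linear_combination (-1) ^ (n + 1 - k) * ((n + 1).choose k : ℚ) * h3
    rw [← sub_eq_zero, ← derivative_sub] at hder
    rw [← sub_eq_zero, ← eval_sub] at heval
    rw [← sub_eq_zero]
    have h4 := derivative_eq_zero.1 hder
    rw [eq_C_of_natDegree_eq_zero h4, eval_C] at heval
    rw [eq_C_of_natDegree_eq_zero h4, heval, C_0]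

/-- Abel's binomial identity at `x = 1`. -/
theorem abel_identity (n : ℕ) (y : ℚ) :
    ∑ p ∈ antidiagonal n, (n.choose p.1 : ℚ) * ((p.1 : ℚ) + 1) ^ (p.1 - 1) * (y - p.1) ^ p.2 =
      (y + 1) ^ n := by
  have h := congrArg (Polynomial.eval y) (abel_polynomial n)
  simp only [Polynomial.eval_finsetSum, Polynomial.eval_mul, Polynomial.eval_C,
    Polynomial.eval_pow, Polynomial.eval_sub, Polynomial.eval_X, Polynomial.eval_add,
    Polynomial.eval_one] at h
  rw [← h]
  exact Finset.Nat.sum_antidiagonal_eq_sum_range_succ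
    (fun a b => (n.choose a : ℚ) * ((a : ℚ) + 1) ^ (a - 1) * (y - a) ^ b) n

/-- The symmetric form of Abel's binomial identity at `x = y = 1`. -/
theorem abel_identity_symm (n : ℕ) :
    ((n : ℚ) + 2) * ∑ p ∈ antidiagonal n, (n.choose p.1 : ℚ) *
      (((p.1 : ℚ) + 1) ^ (p.1 - 1) * ((p.2 : ℚ) + 1) ^ (p.2 - 1)) =
      2 * ((n : ℚ) + 2) ^ n := by
  rcases n with _ | n
  · norm_num
  have h1 := abel_identity (n + 1) ((n : ℚ) + 2)
  have h2 := abel_identity n ((n : ℚ) + 2)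
  have h3 : ∑ p ∈ antidiagonal (n + 1), ((n + 1).choose p.1 : ℚ) *
      (((p.1 : ℚ) + 1) ^ (p.1 - 1) * (p.2 * ((p.2 : ℚ) + 1) ^ (p.2 - 1))) =
      (n + 1) * ((n : ℚ) + 2 + 1) ^ n := by
    rw [Finset.Nat.antidiagonal_succ', Finset.sum_cons, Finset.sum_map]
    simp only [Function.Embedding.prodMap, Function.Embedding.coeFn_mk, Prod.map,
      Function.Embedding.refl_apply]
    rw [← h2, Finset.mul_sum]
    simp only [Nat.cast_zero, zero_mul, mul_zero, zero_add]
    refine Finset.sum_congr rfl fun p hp => ?_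
    have hp' : p.1 + p.2 = n := mem_antidiagonal.1 hp
    have h4 : ((n + 1).choose p.1 : ℚ) * (p.2 + 1) = (n + 1) * n.choose p.1 := by
      have := Nat.choose_mul_succ_eq n p.1
      rw [show n + 1 - p.1 = p.2 + 1 by omega] at this
      have h5 : (n.choose p.1 : ℚ) * (n + 1) = (n + 1).choose p.1 * (p.2 + 1) := by
        exact_mod_cast this
      linear_combination -h5
    have h6 : (n : ℚ) + 2 - p.1 = p.2 + 1 + 1 := by
      rw [← hp']
      push_cast
      ring
    rw [h6]
    simp only [Nat.succ_eq_add_one, Nat.add_sub_cancel]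
    push_cast
    linear_combination ((p.1 : ℚ) + 1) ^ (p.1 - 1) * ((p.2 : ℚ) + 1 + 1) ^ p.2 * h4
  have h7 : ∑ p ∈ antidiagonal (n + 1), ((n + 1).choose p.1 : ℚ) *
      (((p.1 : ℚ) + 1) ^ (p.1 - 1) * (((p.2 : ℚ) + 1) * ((p.2 : ℚ) + 1) ^ (p.2 - 1))) =
      ((n : ℚ) + 2 + 1) ^ (n + 1) := by
    rw [← h1]
    refine Finset.sum_congr rfl fun p hp => ?_
    have hp' : p.1 + p.2 = n + 1 := mem_antidiagonal.1 hp
    have h6 : (n : ℚ) + 2 - p.1 = p.2 + 1 := by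
      have : (p.1 : ℚ) + p.2 = n + 1 := by exact_mod_cast hp'
      linarith
    rw [h6]
    rcases p.2 with _ | q
    · simp
    · rw [← pow_succ', Nat.add_sub_cancel]
      ring
  have h8 : ∑ p ∈ antidiagonal (n + 1), ((n + 1).choose p.1 : ℚ) *
      (((p.1 : ℚ) + 1) ^ (p.1 - 1) * ((p.2 : ℚ) + 1) ^ (p.2 - 1)) =
      ((n : ℚ) + 2 + 1) ^ (n + 1) - (n + 1) * ((n : ℚ) + 2 + 1) ^ n := by
    rw [← h7, ← h3, ← Finset.sum_sub_distrib]
    refine Finset.sum_congr rfl fun p hp => ?_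
    ring
  rw [h8]
  push_cast
  ring

end SignedPerm

namespace SignedPerm
open Module
open Finset.HasAntidiagonal (antidiagonal mem_antidiagonal)

/-- The signed `n`-cycle `f ↦ (f 1, …, f (n - 1), δ * f 0)`. -/
def cyc (n : ℕ) (δ : ℤˣ) : Module.End ℚ (Fin n → ℚ) where
  toFun f x := if h : (x : ℕ) + 1 < n then f ⟨x + 1, h⟩ else ((δ : ℤ) : ℚ) * f ⟨0, x.pos⟩
  map_add' f g := by
    funext x
    simp only [Pi.add_apply]
    split_ifs <;> ring
  map_smul' a f := by
    funext x
    simp only [Pi.smul_apply, smul_eq_mul, RingHom.id_apply]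
    split_ifs <;> ring

theorem cyc_apply (n : ℕ) (δ : ℤˣ) (f : Fin n → ℚ) (x : Fin n) :
    cyc n δ f x =
      if h : (x : ℕ) + 1 < n then f ⟨x + 1, h⟩ else ((δ : ℤ) : ℚ) * f ⟨0, x.pos⟩ := rfl

theorem eq_of_mem_fixed_cyc {n : ℕ} {δ : ℤˣ} {f : Fin n → ℚ} (hf : f ∈ fixed (cyc n δ))
    (k : ℕ) (hk : k < n) : f ⟨k, hk⟩ = f ⟨0, by omega⟩ := by
  induction k with
  | zero => rfl
  | succ k ih =>
    rw [← ih (by omega)]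
    have := congrFun (mem_fixed.1 hf) ⟨k, by omega⟩
    rw [cyc_apply, dif_pos hk] at this
    exact this

theorem one_mem_fixed_cyc (n : ℕ) : (fun _ => 1) ∈ fixed (cyc n 1) := by
  rw [mem_fixed]
  funext x
  rw [cyc_apply]
  split_ifs <;> simp

theorem finrank_fixed_cyc_one (p : ℕ) : finrank ℚ (fixed (cyc (p + 1) 1)) = 1 := by
  rw [finrank_eq_one_iff']
  refine ⟨⟨fun _ => 1, one_mem_fixed_cyc _⟩, ?_, ?_⟩
  · intro h
    have := congrFun (congrArg Subtype.val h) 0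
    simp at this
  · rintro ⟨f, hf⟩
    refine ⟨f 0, ?_⟩
    apply Subtype.ext
    funext x
    have := eq_of_mem_fixed_cyc hf x x.2
    simpa using this.symm

theorem fixed_cyc_neg_one (n : ℕ) : fixed (cyc n (-1)) = ⊥ := by
  rw [eq_bot_iff]
  intro f hf
  rw [Submodule.mem_bot]
  funext x
  have h1 := eq_of_mem_fixed_cyc hf x x.2
  have h2 := eq_of_mem_fixed_cyc hf (n - 1) (by have := x.pos; omega)
  have h3 := congrFun (mem_fixed.1 hf) ⟨n - 1, by have := x.pos; omega⟩
  rw [cyc_apply, dif_neg (by simp; have := x.pos; omega)] at h3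
  rw [h2] at h3
  simp only [Units.val_neg, Units.val_one, Int.cast_neg, Int.cast_one] at h3
  simp only [Fin.eta] at h1
  rw [h1, Pi.zero_apply]
  linarith

theorem fixed_neg_one {ι : Type} : fixed (-1 : Module.End ℚ (ι → ℚ)) = ⊥ := by
  rw [eq_bot_iff]
  intro f hf
  rw [Submodule.mem_bot]
  funext x
  have : -f x = f x := congrFun (mem_fixed.1 hf) x
  rw [Pi.zero_apply]
  linarith

theorem fixed_blockSum_cyc_neg_one (n : ℕ) :
    finrank ℚ (fixed (blockSum (cyc n (-1)) (-1 : Module.End ℚ (Fin 1 → ℚ)))) = 0 := by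
  have := finrank_fixed_blockSum_le (cyc n (-1)) (-1 : Module.End ℚ (Fin 1 → ℚ))
  rw [fixed_cyc_neg_one, fixed_neg_one, finrank_bot, finrank_bot] at this
  omega

/-- Multiplying a signed cycle by a reflection splits it into two cycles. -/
theorem reindex_cyc_mul_refl {n d e : ℕ} (h : d + e = n) (hd : 0 < d) (he : 0 < e) (δ : ℤˣ)
    (f : Fin n → ℚ) :
    reindex (finSumFinEquiv.trans (finCongr h)) (fun _ => 1)
        ((cyc n δ * refl (⟨0, by omega⟩ : Fin n) (⟨d, by omega⟩ : Fin n) 1) f) =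
      blockSum (cyc d 1) (cyc e δ)
        (reindex (finSumFinEquiv.trans (finCongr h)) (fun _ => 1) f) := by
  subst h
  funext x
  rcases x with x | x
  · have hx := x.2
    simp only [reindex_apply, blockSum_apply_inl, cyc_apply, Module.End.mul_apply, refl_apply,
      Fin.ext_iff, Equiv.trans_apply, finSumFinEquiv_apply_left,
      finCongr_apply, Fin.val_cast, Fin.val_castAdd, Units.val_one, Int.cast_one,
      one_mul]
    by_cases h1 : (x : ℕ) + 1 < d
    · rw [dif_pos (by omega), if_neg (by omega), if_neg (by omega), dif_pos h1]
      congr 1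
    · rw [dif_pos (by omega), if_neg (by omega), if_pos (by omega), dif_neg h1]
      congr 1
  · have hx := x.2
    simp only [reindex_apply, blockSum_apply_inr, cyc_apply, Module.End.mul_apply, refl_apply,
      Fin.ext_iff, Equiv.trans_apply, finSumFinEquiv_apply_right,
      finCongr_apply, Fin.val_cast, Fin.val_natAdd, Units.val_one, Int.cast_one,
      one_mul]
    by_cases h1 : (x : ℕ) + 1 < e
    · rw [dif_pos (by omega), if_neg (by omega), if_neg (by omega), dif_pos h1]
      congr 1
    · rw [dif_neg (by omega), if_pos True.intro, dif_neg h1]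
      congr 1

theorem refl_comm {ι : Type} [DecidableEq ι] (i j : ι) (ε : ℤˣ) : refl i j ε = refl j i ε := by
  refine LinearMap.ext fun f => funext fun x => ?_
  rw [refl_apply, refl_apply]
  by_cases h1 : x = i <;> by_cases h2 : x = j <;> simp [h1, h2]
  · subst h1
    simp [← h2]
  · intro h3
    exact absurd (h1.trans h3) h2
  · rintro rfl
    exact absurd h2 h1

/-- The signs of the signed cycle `cyc (p + 1) δ`. -/
def cycSign (p : ℕ) (δ : ℤˣ) (x : Fin (p + 1)) : ℤˣ := if (x : ℕ) + 1 < p + 1 then 1 else δ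

theorem reindex_finRotate (p : ℕ) (δ : ℤˣ) (f : Fin (p + 1) → ℚ) :
    reindex (finRotate (p + 1)) (cycSign p δ) f = cyc (p + 1) δ f := by
  funext x
  rw [reindex_apply, cyc_apply, cycSign]
  split_ifs with h
  · rw [finRotate_of_lt (by omega)]
    simp
  · have hx : x = Fin.last p := Fin.ext (by simp; omega)
    subst hx
    rw [finRotate_last]
    rfl

theorem cyc_refl (p : ℕ) (δ : ℤˣ) (i j : Fin (p + 1)) (ε : ℤˣ) (f : Fin (p + 1) → ℚ) :
    cyc (p + 1) δ (refl (finRotate (p + 1) i) (finRotate (p + 1) j)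
      (cycSign p δ i * cycSign p δ j * ε) f) = refl i j ε (cyc (p + 1) δ f) := by
  rw [← reindex_finRotate, reindex_refl, reindex_finRotate]

/-- `F` takes equal values on elements conjugate under `cyc (p + 1) δ`. -/
def CycInvariant (p : ℕ) (δ : ℤˣ) (F : Module.End ℚ (Fin (p + 1) → ℚ) → ℚ) : Prop :=
  ∀ w w', (∀ f, cyc (p + 1) δ (w f) = w' (cyc (p + 1) δ f)) → F w' = F w

theorem cycInvariant_factCount (p : ℕ) (δ : ℤˣ) (k : ℕ) :
    CycInvariant p δ (factCount (Fin (p + 1)) k) := by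
  intro w w' h
  refine factCount_reindex (finRotate (p + 1)) (cycSign p δ) k w w' fun f => ?_
  rw [reindex_finRotate, reindex_finRotate, h]

theorem reindex_sumCongr {ι ι' κ κ' : Type} (σ : κ ≃ ι) (η : κ → ℤˣ) (σ' : κ' ≃ ι')
    (η' : κ' → ℤˣ) {u : Module.End ℚ (ι → ℚ)} {u' : Module.End ℚ (κ → ℚ)}
    {v : Module.End ℚ (ι' → ℚ)} {v' : Module.End ℚ (κ' → ℚ)}
    (hu : ∀ f, reindex σ η (u f) = u' (reindex σ η f))
    (hv : ∀ f, reindex σ' η' (v f) = v' (reindex σ' η' f)) (f : ι ⊕ ι' → ℚ) :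
    reindex (Equiv.sumCongr σ σ') (Sum.elim η η') (blockSum u v f) =
      blockSum u' v' (reindex (Equiv.sumCongr σ σ') (Sum.elim η η') f) := by
  funext x
  rcases x with x | x
  · exact congrFun (hu fun y => f (Sum.inl y)) x
  · exact congrFun (hv fun y => f (Sum.inr y)) x

theorem reindex_neg_one {ι κ : Type} (σ : κ ≃ ι) (η : κ → ℤˣ) (f : ι → ℚ) :
    reindex σ η ((-1 : Module.End ℚ (ι → ℚ)) f) =
      (-1 : Module.End ℚ (κ → ℚ)) (reindex σ η f) := by
  have h1 : (-1 : Module.End ℚ (ι → ℚ)) f = -f := rfl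
  have h2 : (-1 : Module.End ℚ (κ → ℚ)) (reindex σ η f) = -(reindex σ η f) := rfl
  rw [h1, h2, map_neg]

theorem cycInvariant_factCount_blockSum (p : ℕ) (δ : ℤˣ) (k : ℕ) :
    CycInvariant p δ fun w =>
      factCount (Fin (p + 1) ⊕ Fin 1) k (blockSum w (-1 : Module.End ℚ (Fin 1 → ℚ))) := by
  intro w w' h
  refine factCount_reindex _ _ k _ _ (reindex_sumCongr (finRotate (p + 1)) (cycSign p δ)
    (Equiv.refl _) (fun _ => 1) (fun f => ?_) (reindex_neg_one _ _))
  rw [reindex_finRotate, reindex_finRotate, h]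

theorem CycInvariant.rotate {p : ℕ} {δ : ℤˣ} {F : Module.End ℚ (Fin (p + 1) → ℚ) → ℚ}
    (hF : CycInvariant p δ F) (i j : Fin (p + 1)) (ε : ℤˣ) :
    F (cyc (p + 1) δ * refl (finRotate (p + 1) i) (finRotate (p + 1) j)
      (cycSign p δ i * cycSign p δ j * ε)) = F (cyc (p + 1) δ * refl i j ε) := by
  symm
  refine hF _ _ fun f => ?_
  rw [Module.End.mul_apply, Module.End.mul_apply, cyc_refl]

theorem CycInvariant.sum_eq {p : ℕ} {δ : ℤˣ} {F : Module.End ℚ (Fin (p + 1) → ℚ) → ℚ}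
    (hF : CycInvariant p δ F) :
    (∑ i, ∑ j, ∑ ε : ℤˣ, if i = j then 0 else F (cyc (p + 1) δ * refl i j ε)) =
      (p + 1) * ∑ d : Fin p, (F (cyc (p + 1) δ * refl 0 d.succ 1) +
        F (cyc (p + 1) δ * refl 0 d.succ (-1))) := by
  set H : Fin (p + 1) → ℚ := fun i =>
    ∑ j, ∑ ε : ℤˣ, if i = j then 0 else F (cyc (p + 1) δ * refl i j ε) with hH
  have hrot : ∀ i, H (finRotate (p + 1) i) = H i := by
    intro i
    simp only [hH]
    rw [← Equiv.sum_comp (finRotate (p + 1))]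
    refine Finset.sum_congr rfl fun j _ => ?_
    rw [← Equiv.sum_comp (Equiv.mulLeft (cycSign p δ i * cycSign p δ j))]
    refine Finset.sum_congr rfl fun ε _ => ?_
    simp only [EmbeddingLike.apply_eq_iff_eq, Equiv.coe_mulLeft, hF.rotate]
  have hconst : ∀ (k : ℕ) (hk : k < p + 1), H ⟨k, hk⟩ = H 0 := by
    intro k
    induction k with
    | zero => intro _; rfl
    | succ k ih =>
      intro hk
      rw [← ih (by omega), ← hrot ⟨k, by omega⟩, finRotate_of_lt (by omega)]
  have hall : ∀ i, H i = H 0 := fun i => hconst i i.2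
  rw [Finset.sum_congr rfl fun i _ => hall i, Finset.sum_const, Finset.card_univ, Fintype.card_fin,
    nsmul_eq_mul]
  push_cast
  congr 1
  simp only [hH]
  rw [Fin.sum_univ_succ]
  simp only [if_true, Finset.sum_const_zero, zero_add]
  refine Finset.sum_congr rfl fun d _ => ?_
  simp [UnitsInt.univ, (Fin.succ_ne_zero d).symm]

theorem CycInvariant.shift {p : ℕ} {δ : ℤˣ} {F : Module.End ℚ (Fin (p + 1) → ℚ) → ℚ}
    (hF : CycInvariant p δ F) (ε : ℤˣ) (i j : ℕ) (h : i + j < p + 1) :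
    F (cyc (p + 1) δ * refl ⟨i, by omega⟩ ⟨i + j, h⟩ ε) =
      F (cyc (p + 1) δ * refl 0 ⟨j, by omega⟩ ε) := by
  induction i with
  | zero =>
    simp only [Nat.zero_add]
    rfl
  | succ i ih =>
    rw [← ih (by omega), ← hF.rotate ⟨i, by omega⟩ ⟨i + j, by omega⟩ ε,
      finRotate_of_lt (by omega), finRotate_of_lt (by omega)]
    have h1 : cycSign p δ ⟨i, by omega⟩ = 1 := if_pos (by simp; omega)
    have h2 : cycSign p δ ⟨i + j, by omega⟩ = 1 := if_pos (by simp; omega)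
    rw [h1, h2, one_mul, one_mul]
    congr 3
    apply Fin.ext
    simp
    omega

theorem CycInvariant.neg_eq {p : ℕ} {F : Module.End ℚ (Fin (p + 1) → ℚ) → ℚ}
    (hF : CycInvariant p (-1) F) (d : Fin p) :
    F (cyc (p + 1) (-1) * refl 0 d.succ (-1)) = F (cyc (p + 1) (-1) * refl 0 d.rev.succ 1) := by
  have h1 := hF.shift (-1) (p - 1 - d) (d + 1) (by omega)
  have h2 := hF.rotate ⟨p - 1 - d, by omega⟩ ⟨p - 1 - d + (d + 1), by omega⟩ (-1)
  have h3 : (⟨p - 1 - d + (d + 1), by omega⟩ : Fin (p + 1)) = Fin.last p :=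
    Fin.ext (by simp; omega)
  have h4 : cycSign p (-1) ⟨p - 1 - d, by omega⟩ = 1 := if_pos (by simp; omega)
  have h5 : cycSign p (-1) (Fin.last p) = -1 := if_neg (by simp)
  rw [h1, h3, finRotate_of_lt (by omega), finRotate_last, h4, h5, refl_comm] at h2
  have h6 : (⟨d + 1, by omega⟩ : Fin (p + 1)) = d.succ := rfl
  rw [h6] at h2
  rw [← h2]
  have h7 : (⟨p - 1 - d + 1, by omega⟩ : Fin (p + 1)) = d.rev.succ :=
    Fin.ext (by simp; omega)
  simp only [h7]
  norm_num

end SignedPerm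

namespace SignedPerm
open Module
open Finset.HasAntidiagonal (antidiagonal mem_antidiagonal)

theorem sum_fin_eq_sum_antidiagonal (q : ℕ) (g : ℕ → ℕ → ℚ) :
    ∑ d : Fin (q + 1), g d (q - d) = ∑ p ∈ antidiagonal q, g p.1 p.2 := by
  rw [Finset.Nat.sum_antidiagonal_eq_sum_range_succ, Finset.sum_range]

theorem factCount_cyc_mul_refl {q a b : ℕ} (h : a + b = q) (ha : a + 1 < q + 2) :
    factCount (Fin (q + 2)) q (cyc (q + 2) 1 * refl 0 (⟨a + 1, ha⟩ : Fin (q + 2)) 1) =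
      (q.choose a : ℚ) * (factCount (Fin (a + 1)) a (cyc (a + 1) 1) *
        factCount (Fin (b + 1)) b (cyc (b + 1) 1)) := by
  subst h
  rw [← factCount_blockSum_of_card_eq a b _ _ (one_mem_fixed_cyc _)
    (by rw [finrank_fixed_cyc_one, Fintype.card_fin])
    (by rw [finrank_fixed_cyc_one, Fintype.card_fin])]
  exact (factCount_reindex _ _ _ _ _ (reindex_cyc_mul_refl (by omega) (by omega) (by omega) 1)).symm

theorem factCount_cyc_mul_refl_neg {q : ℕ} (d : Fin (q + 1)) :
    factCount (Fin (q + 2)) q (cyc (q + 2) 1 * refl 0 d.succ (-1)) = 0 := by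
  by_contra h
  have h1 := fixed_le_fixed_refl
    (by rw [finrank_fixed_cyc_one (q + 1), Fintype.card_fin]) h (one_mem_fixed_cyc _)
  have h2 := congrFun (mem_fixed.1 h1) 0
  rw [refl_apply, if_pos rfl] at h2
  norm_num at h2

/-- The number of minimal factorizations of an `(p + 1)`-cycle into reflections. -/
theorem factCount_cyc (p : ℕ) :
    factCount (Fin (p + 1)) p (cyc (p + 1) 1) = ((p : ℚ) + 1) ^ (p - 1) := by
  induction p using Nat.strong_induction_on with
  | _ p ih =>
  rcases p with _ | q
  · have : cyc (0 + 1) 1 = 1 := by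
      refine LinearMap.ext fun f => funext fun x => ?_
      rw [cyc_apply, dif_neg (by omega)]
      simp only [Units.val_one, Int.cast_one, one_mul]
      exact congrArg f (Fin.ext (by simp))
    rw [this]
    simp [factCount]
  · rw [factCount, (cycInvariant_factCount (q + 1) 1 q).sum_eq]
    have h1 : ∀ d : Fin (q + 1), factCount (Fin (q + 2)) q (cyc (q + 2) 1 * refl 0 d.succ 1) +
        factCount (Fin (q + 2)) q (cyc (q + 2) 1 * refl 0 d.succ (-1)) =
        (q.choose d : ℚ) * ((((d : ℕ) : ℚ) + 1) ^ ((d : ℕ) - 1) *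
          (((q - d : ℕ) : ℚ) + 1) ^ (q - d - 1)) := by
      intro d
      have hd := d.2
      rw [factCount_cyc_mul_refl_neg, add_zero, ← ih d (by omega), ← ih (q - d) (by omega)]
      exact factCount_cyc_mul_refl (by omega) _
    rw [Finset.sum_congr rfl fun d _ => h1 d, sum_fin_eq_sum_antidiagonal q fun a b =>
      (q.choose a : ℚ) * (((a : ℚ) + 1) ^ (a - 1) * ((b : ℚ) + 1) ^ (b - 1))]
    have h2 := abel_identity_symm q
    push_cast
    linear_combination (1 / 2 : ℚ) * h2

theorem reindex_sumAssoc {ι κ ξ : Type} (u : Module.End ℚ (ι → ℚ)) (v : Module.End ℚ (κ → ℚ))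
    (w : Module.End ℚ (ξ → ℚ)) (f : (ι ⊕ κ) ⊕ ξ → ℚ) :
    reindex (Equiv.sumAssoc ι κ ξ).symm (fun _ => 1) (blockSum (blockSum u v) w f) =
      blockSum u (blockSum v w) (reindex (Equiv.sumAssoc ι κ ξ).symm (fun _ => 1) f) := by
  funext x
  rcases x with x | x | x <;>
  simp [reindex_apply, blockSum_apply_inl, blockSum_apply_inr]

/-- The number of minimal factorizations of a type `D` Coxeter element of rank `m + 1`. -/
noncomputable def coxCount (m : ℕ) : ℚ :=
  factCount (Fin m ⊕ Fin 1) (m + 1) (blockSum (cyc m (-1)) (-1))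

theorem factCount_blockSum_cyc_mul_refl {p a b : ℕ} (h : a + b = p) (hb : 0 < b)
    (ha : a + 1 < p + 1) :
    factCount (Fin (p + 1) ⊕ Fin 1) (p + 1)
        (blockSum (cyc (p + 1) (-1) * refl 0 (⟨a + 1, ha⟩ : Fin (p + 1)) 1) (-1)) =
      ((p + 1).choose a : ℚ) * (factCount (Fin (a + 1)) a (cyc (a + 1) 1) * coxCount b) := by
  subst h
  rw [coxCount]
  have h1 := factCount_blockSum_of_card_eq a (b + 1) (cyc (a + 1) 1)
    (blockSum (cyc b (-1)) (-1 : Module.End ℚ (Fin 1 → ℚ))) (one_mem_fixed_cyc _)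
    (by rw [finrank_fixed_cyc_one, Fintype.card_fin])
    (by rw [fixed_blockSum_cyc_neg_one]; simp)
  rw [← add_assoc] at h1
  rw [← h1, factCount_reindex _ _ _ _ _ (reindex_sumAssoc (cyc (a + 1) 1) (cyc b (-1)) (-1))]
  exact (factCount_reindex _ _ _ _ _ (reindex_sumCongr _ _ (Equiv.refl (Fin 1)) (fun _ => 1)
    (reindex_cyc_mul_refl (by omega) (by omega) hb (-1)) (reindex_neg_one _ _))).symm

theorem factCount_blockSum_neg (p k : ℕ) (i : Fin (p + 1)) (ε : ℤˣ) :
    factCount (Fin (p + 1) ⊕ Fin 1) k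
        (blockSum (cyc (p + 1) (-1)) (-1) * refl (Sum.inl i) (Sum.inr 0) (-ε)) =
      factCount (Fin (p + 1) ⊕ Fin 1) k
        (blockSum (cyc (p + 1) (-1)) (-1) * refl (Sum.inl i) (Sum.inr 0) ε) := by
  symm
  have hid : ∀ f : Fin (p + 1) → ℚ, reindex (Equiv.refl _) (fun _ => 1) f = f := fun f =>
    funext fun x => by simp [reindex_apply]
  refine factCount_reindex (Equiv.sumCongr (Equiv.refl _) (Equiv.refl _))
    (Sum.elim (fun _ => 1) (fun _ => -1)) k _ _ fun f => ?_
  rw [Module.End.mul_apply, reindex_sumCongr _ _ _ _ (u' := cyc (p + 1) (-1)) (v' := -1)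
    (fun f => by rw [hid, hid]) (reindex_neg_one _ _), Module.End.mul_apply, ← reindex_refl]
  simp

theorem factCount_blockSum_rotate (p k : ℕ) (i : Fin (p + 1)) (ε : ℤˣ) :
    factCount (Fin (p + 1) ⊕ Fin 1) k (blockSum (cyc (p + 1) (-1)) (-1) *
        refl (Sum.inl (finRotate (p + 1) i)) (Sum.inr 0) (cycSign p (-1) i * ε)) =
      factCount (Fin (p + 1) ⊕ Fin 1) k
        (blockSum (cyc (p + 1) (-1)) (-1) * refl (Sum.inl i) (Sum.inr 0) ε) := by
  symm
  refine factCount_reindex (Equiv.sumCongr (finRotate (p + 1)) (Equiv.refl _))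
    (Sum.elim (cycSign p (-1)) (fun _ => 1)) k _ _ fun f => ?_
  rw [Module.End.mul_apply, reindex_sumCongr _ _ _ _ (u' := cyc (p + 1) (-1)) (v' := -1)
    (fun f => by rw [reindex_finRotate, reindex_finRotate]) (reindex_neg_one _ _),
    Module.End.mul_apply, ← reindex_refl]
  simp

theorem factCount_blockSum_mul_refl_inr (p k : ℕ) (i : Fin (p + 1)) (ε : ℤˣ) :
    factCount (Fin (p + 1) ⊕ Fin 1) k
        (blockSum (cyc (p + 1) (-1)) (-1) * refl (Sum.inl i) (Sum.inr 0) ε) =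
      factCount (Fin (p + 2)) k (cyc (p + 2) 1) := by
  obtain ⟨i, hi⟩ := i
  induction i generalizing ε with
  | zero =>
    trans factCount (Fin (p + 1) ⊕ Fin 1) k
      (blockSum (cyc (p + 1) (-1)) (-1) * refl (Sum.inl 0) (Sum.inr 0) (-1))
    · rcases Int.units_eq_one_or ε with rfl | rfl
      · exact (factCount_blockSum_neg p k 0 1).symm
      · rfl
    refine factCount_reindex finSumFinEquiv (fun _ => 1) k _ _ fun f => ?_
    funext x
    rcases x with x | x
    · have hx := x.2
      simp only [reindex_apply, blockSum_apply_inl, cyc_apply, Module.End.mul_apply, refl_apply,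
        finSumFinEquiv_apply_left, finSumFinEquiv_apply_right, Fin.val_castAdd]
      by_cases h : (x : ℕ) + 1 < p + 1
      · rw [dif_pos h, dif_pos (by omega), if_neg (fun h0 => by simpa using congrArg Fin.val (Sum.inl_injective h0)),
          if_neg (by simp)]
        simp only [Units.val_one, Int.cast_one, one_mul]
        rfl
      · rw [dif_neg h, dif_pos (by omega)]
        have h0 : (Sum.inl ⟨0, by omega⟩ : Fin (p + 1) ⊕ Fin 1) = Sum.inl 0 := rfl
        rw [if_pos h0]
        have : (⟨x + 1, by omega⟩ : Fin (p + 1 + 1)) = Fin.natAdd (p + 1) (0 : Fin 1) :=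
          Fin.ext (by simp; omega)
        rw [this]
        norm_num
    · have h0 : x = 0 := Subsingleton.elim _ _
      subst h0
      have : ∀ g : Fin 1 → ℚ, (-1 : Module.End ℚ (Fin 1 → ℚ)) g 0 = -g 0 := fun _ => rfl
      rw [Module.End.mul_apply, blockSum_apply_inr, this]
      simp [reindex_apply, cyc_apply, refl_apply]
      rfl
  | succ i ih =>
    have h := factCount_blockSum_rotate p k ⟨i, by omega⟩ ε
    have h1 : cycSign p (-1) ⟨i, by omega⟩ = 1 := if_pos (by simp; omega)
    rw [h1, one_mul, finRotate_of_lt (by omega)] at h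
    rw [h, ih]

theorem coxCount_succ (p : ℕ) : coxCount (p + 1) =
    (p + 1) * ∑ d : Fin p, ((p + 1).choose d : ℚ) *
      ((((d : ℕ) : ℚ) + 1) ^ ((d : ℕ) - 1) * coxCount (p - d)) + 2 * (p + 1) * ((p : ℚ) + 2) ^ p := by
  have hsplit : ∀ d : Fin p, factCount (Fin (p + 1) ⊕ Fin 1) (p + 1)
      (blockSum (cyc (p + 1) (-1) * refl 0 d.succ 1) (-1)) = ((p + 1).choose d : ℚ) *
      ((((d : ℕ) : ℚ) + 1) ^ ((d : ℕ) - 1) * coxCount (p - d)) := by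
    intro d
    have hd := d.2
    rw [← factCount_cyc]
    exact factCount_blockSum_cyc_mul_refl (by omega) (by omega) _
  have hα : factCount (Fin (p + 2)) (p + 1) (cyc (p + 2) 1) = ((p : ℚ) + 2) ^ p := by
    have := factCount_cyc (p + 1)
    push_cast at this
    rw [this]
    norm_num [add_assoc]
  have hinv := cycInvariant_factCount_blockSum p (-1) (p + 1)
  have h1 := hinv.sum_eq
  have h2 : ∀ d : Fin p, _ := hinv.neg_eq
  simp only [h2, Finset.sum_add_distrib, ← Fin.revPerm_apply] at h1
  rw [Equiv.sum_comp Fin.revPerm fun d : Fin p => factCount (Fin (p + 1) ⊕ Fin 1) (p + 1)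
      (blockSum (cyc (p + 1) (-1) * refl 0 d.succ 1) (-1))] at h1
  rw [coxCount, factCount]
  simp only [Fintype.sum_sum_type, Sum.inl.injEq, Sum.inr.injEq, reduceCtorEq, if_false,
    Finset.univ_unique, Finset.sum_singleton, blockSum_mul_refl_inl, if_true,
    Finset.sum_add_distrib, Fin.default_eq_zero, refl_comm (Sum.inr _) (Sum.inl _),
    factCount_blockSum_mul_refl_inr, h1, hsplit, hα]
  simp
  ring

/-- The number of minimal factorizations of a type `D` Coxeter element. -/
theorem coxCount_eq (p : ℕ) : coxCount (p + 1) = 2 * ((p : ℚ) + 1) ^ (p + 2) := by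
  induction p using Nat.strong_induction_on with
  | _ p ih =>
  rw [coxCount_succ]
  have h1 : ∀ d : Fin p, coxCount (p - d) = 2 * ((p : ℚ) - (d : ℕ)) ^ (p + 1 - d) := by
    intro d
    have hd := d.2
    have := ih (p - d - 1) (by omega)
    rw [show p - d - 1 + 1 = p - d by omega, show p - d - 1 + 2 = p + 1 - d by omega] at this
    rw [this, Nat.cast_sub (by omega), Nat.cast_sub (by omega)]
    push_cast
    ring
  simp only [h1]
  have h2 := abel_identity (p + 1) p
  rw [Finset.Nat.sum_antidiagonal_eq_sum_range_succ fun a b => ((p + 1).choose a : ℚ) *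
    ((a : ℚ) + 1) ^ (a - 1) * ((p : ℚ) - a) ^ b, Finset.sum_range_succ, Finset.sum_range_succ,
    Finset.sum_range] at h2
  simp only [Nat.choose_self, Nat.sub_self, sub_self, Nat.cast_add, Nat.cast_one] at h2
  simp at h2
  rw [pow_succ, ← h2]
  have h3 : ∀ d : Fin p, ((p + 1).choose d : ℚ) * ((((d : ℕ) : ℚ) + 1) ^ ((d : ℕ) - 1) *
      (2 * ((p : ℚ) - (d : ℕ)) ^ (p + 1 - d))) = 2 * (((p + 1).choose d : ℚ) *
      (((d : ℕ) : ℚ) + 1) ^ ((d : ℕ) - 1) * ((p : ℚ) - (d : ℕ)) ^ (p + 1 - d)) := fun d => by ring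
  simp only [h3, ← Finset.mul_sum]
  rw [add_assoc (p : ℚ) 1 1, one_add_one_eq_two]
  ring

end SignedPerm

/-- `w` is a product of `k` reflections. -/
def IsReflectionProduct {G : Type*} [Group G] (S : Set G) (k : ℕ) (w : G) : Prop :=
  ∃ l : List G, (∀ t ∈ l, IsReflectionOf S t) ∧ l.length = k ∧ l.prod = w

section Chains

variable {G : Type*} [Group G] {S : Set G}

theorem IsReflectionOf.conj {t : G} (ht : IsReflectionOf S t) (g : G) :
    IsReflectionOf S (g * t * g⁻¹) := by
  obtain ⟨h, s, hs, rfl⟩ := ht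
  exact ⟨g * h, s, hs, by group⟩

theorem isReflectionOf_conj_iff {t : G} (g : G) :
    IsReflectionOf S (g * t * g⁻¹) ↔ IsReflectionOf S t :=
  ⟨fun h => by simpa [mul_assoc] using h.conj g⁻¹, fun h => h.conj g⟩

theorem IsReflectionOf.mul_self (hS : ∀ s ∈ S, s * s = 1) {t : G} (ht : IsReflectionOf S t) :
    t * t = 1 := by
  obtain ⟨h, s, hs, rfl⟩ := ht
  have : h * s * h⁻¹ * (h * s * h⁻¹) = h * (s * s) * h⁻¹ := by group
  rw [this, hS s hs]
  group

theorem IsReflectionProduct.mul {k l : ℕ} {u v : G} (hu : IsReflectionProduct S k u)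
    (hv : IsReflectionProduct S l v) : IsReflectionProduct S (k + l) (u * v) := by
  obtain ⟨a, ha, rfl, rfl⟩ := hu
  obtain ⟨b, hb, rfl, rfl⟩ := hv
  refine ⟨a ++ b, fun t ht => ?_, by simp, by simp⟩
  exact (List.mem_append.1 ht).elim (ha t) (hb t)

theorem IsReflectionProduct.one : IsReflectionProduct S 0 (1 : G) := ⟨[], by simp, rfl, rfl⟩

theorem isReflectionProduct_one_iff {t : G} :
    IsReflectionProduct S 1 t ↔ IsReflectionOf S t := by
  constructor
  · rintro ⟨l, hl, h1, rfl⟩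
    obtain ⟨a, rfl⟩ := List.length_eq_one_iff.1 h1
    simpa using hl
  · intro h
    exact ⟨[t], by simpa using h, rfl, by simp⟩

theorem IsReflectionProduct.absLength_le {k : ℕ} {w : G} (h : IsReflectionProduct S k w) :
    absLength S w ≤ k := Nat.sInf_le h

theorem IsReflectionProduct.absLength {k : ℕ} {w : G} (h : IsReflectionProduct S k w) :
    IsReflectionProduct S (absLength S w) w :=
  Nat.sInf_mem (s := {k | IsReflectionProduct S k w}) ⟨k, h⟩

theorem isReflectionProduct_of_absLength_eq {k : ℕ} {w : G} (h : absLength S w = k + 1) :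
    IsReflectionProduct S (k + 1) w := by
  have : {k | IsReflectionProduct S k w}.Nonempty := by
    by_contra h0
    rw [Set.not_nonempty_iff_eq_empty] at h0
    have h1 : absLength S w = sInf {k | IsReflectionProduct S k w} := rfl
    rw [h0, Nat.sInf_empty] at h1
    omega
  rw [← h]
  exact Nat.sInf_mem this

/-- `y` is a path of length `k` from `1` to `w` whose steps are right multiplications by
reflections. -/
def IsReflectionPath (S : Set G) (k : ℕ) (w : G) (y : Fin (k + 1) → G) : Prop :=
  y 0 = 1 ∧ y (Fin.last k) = w ∧
    ∀ i : Fin k, IsReflectionOf S ((y i.castSucc)⁻¹ * y i.succ)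

/-- The number of reflection paths from `1` to `w`. -/
noncomputable def pathCount (S : Set G) (k : ℕ) (w : G) : ℕ :=
  Nat.card {y : Fin (k + 1) → G // IsReflectionPath S k w y}

theorem IsReflectionPath.isReflectionProduct {k : ℕ} {w : G} {y : Fin (k + 1) → G}
    (hy : IsReflectionPath S k w y) (i d : ℕ) (h : i + d < k + 1) :
    IsReflectionProduct S d ((y ⟨i, by omega⟩)⁻¹ * y ⟨i + d, h⟩) := by
  induction d with
  | zero => simpa using IsReflectionProduct.one
  | succ d ih =>
    have h1 := (ih (by omega)).mul
      (isReflectionProduct_one_iff.2 (hy.2.2 ⟨i + d, by omega⟩))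
    have h2 : ∀ a b c : G, a⁻¹ * b * (b⁻¹ * c) = a⁻¹ * c := fun a b c => by group
    rw [Fin.castSucc_mk, h2] at h1
    exact h1

/-- Maximal chains are the same as minimal reflection paths. -/
theorem maxChainCount_eq_pathCount {c : G} {n : ℕ} (hc : absLength S c = n) :
    maxChainCount S c n = pathCount S n c := by
  refine Nat.card_congr (Equiv.subtypeEquivRight fun y => ⟨?_, ?_⟩)
  · rintro ⟨h0, h1, h2, h3⟩
    refine ⟨h0, h1, fun i => isReflectionProduct_one_iff.1
      (isReflectionProduct_of_absLength_eq (k := 0) ?_)⟩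
    have h4 := h2 i
    rw [absLe, h3, h3] at h4
    simp at h4
    exact h4
  · intro hy
    have hlen : ∀ i : Fin (n + 1), absLength S (y i) = (i : ℕ) := by
      intro i
      have hi := i.2
      have h1 := hy.isReflectionProduct 0 i (by omega)
      have h2 := hy.isReflectionProduct i (n - i) (by omega)
      have e0 : y ⟨0, by omega⟩ = 1 := hy.1
      have e1 : y ⟨i + (n - i), by omega⟩ = c := by
        rw [← hy.2.1]
        congr 1
        exact Fin.ext (by simp; omega)
      rw [e0] at h1
      rw [e1] at h2
      simp only [Nat.zero_add, inv_one, one_mul, Fin.eta] at h1 h2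
      have h3 := (h1.absLength.mul h2).absLength_le
      rw [mul_inv_cancel_left, hc] at h3
      have h4 := h1.absLength_le
      omega
    refine ⟨hy.1, hy.2.1, fun i => ?_, hlen⟩
    have h1 := isReflectionProduct_one_iff.2 (hy.2.2 i)
    have h2 := hy.isReflectionProduct 0 i (by omega)
    have e0 : y ⟨0, by omega⟩ = 1 := hy.1
    rw [e0] at h2
    simp only [Nat.zero_add, inv_one, one_mul] at h2
    have h3 := (h2.absLength.mul h1.absLength).absLength_le
    have h4 : y ⟨i, by omega⟩ = y i.castSucc := rfl
    rw [h4, mul_inv_cancel_left, hlen, hlen] at h3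
    have h5 := h1.absLength_le
    rw [absLe, hlen, hlen]
    simp at h3 ⊢
    omega

theorem pathCount_conj (k : ℕ) (w g : G) : pathCount S k (g * w * g⁻¹) = pathCount S k w := by
  symm
  refine Nat.card_congr (Equiv.subtypeEquiv (Equiv.arrowCongr (Equiv.refl _)
    (MulAut.conj g).toEquiv) fun y => ?_)
  have h : ∀ a b : G, IsReflectionOf S ((g * a * g⁻¹)⁻¹ * (g * b * g⁻¹)) ↔
      IsReflectionOf S (a⁻¹ * b) := by
    intro a b
    rw [show (g * a * g⁻¹)⁻¹ * (g * b * g⁻¹) = g * (a⁻¹ * b) * g⁻¹ by group,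
      isReflectionOf_conj_iff]
  have h1 : ∀ x, (Equiv.arrowCongr (Equiv.refl _) (MulAut.conj g).toEquiv) y x = g * y x * g⁻¹ :=
    fun _ => rfl
  simp only [IsReflectionPath, h1, h]
  simp

theorem pathCount_zero [DecidableEq G] (w : G) : pathCount S 0 w = if w = 1 then 1 else 0 := by
  split_ifs with h
  · subst h
    rw [pathCount, Nat.card_eq_one_iff_unique]
    refine ⟨⟨fun a b => ?_⟩, ⟨⟨fun _ => 1, rfl, rfl, fun i => i.elim0⟩⟩⟩
    apply Subtype.ext
    funext x
    rw [show x = 0 from Fin.ext (by omega), a.2.1, b.2.1]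
  · rw [pathCount, Nat.card_eq_zero]
    left
    refine ⟨fun a => h ?_⟩
    rw [← a.2.2.1, ← a.2.1]
    rfl

/-- Removing the last step of a reflection path. -/
noncomputable def pathEquiv (hS : ∀ s ∈ S, s * s = 1) (k : ℕ) (w : G) :
    {y : Fin (k + 2) → G // IsReflectionPath S (k + 1) w y} ≃
      Σ t : {t : G // IsReflectionOf S t}, {y : Fin (k + 1) → G // IsReflectionPath S k (w * t) y}
    where
  toFun y := ⟨⟨(y.1 (Fin.last k).castSucc)⁻¹ * y.1 (Fin.last (k + 1)), y.2.2.2 (Fin.last k)⟩,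
    ⟨Fin.init y.1, y.2.1, by
      have h := (y.2.2.2 (Fin.last k)).mul_self hS
      have h1 : y.1 (Fin.last (k + 1)) = w := y.2.2.1
      rw [Fin.succ_last] at h
      change y.1 (Fin.last k).castSucc =
        w * ((y.1 (Fin.last k).castSucc)⁻¹ * y.1 (Fin.last (k + 1)))
      rw [← inv_eq_of_mul_eq_one_left h, h1]
      simp, fun i => y.2.2.2 i.castSucc⟩⟩
  invFun p := ⟨Fin.snoc (α := fun _ => G) p.2.1 w, by
    have h := p.2.2.1
    have h0 : (0 : Fin (k + 2)) = Fin.castSucc 0 := rfl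
    rw [h0, Fin.snoc_castSucc, h], Fin.snoc_last _ _, by
    intro i
    induction i using Fin.lastCases with
    | last =>
      have h1 := p.1.2.mul_self hS
      have h2 := p.2.2.2.1
      rw [Fin.succ_last, Fin.snoc_last, Fin.snoc_castSucc, h2, mul_inv_rev, inv_mul_cancel_right,
        inv_eq_of_mul_eq_one_left h1]
      exact p.1.2
    | cast i =>
      rw [Fin.succ_castSucc, Fin.snoc_castSucc, Fin.snoc_castSucc]
      exact p.2.2.2.2 i⟩
  left_inv y := by
    apply Subtype.ext
    have h : y.1 (Fin.last (k + 1)) = w := y.2.2.1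
    change Fin.snoc (Fin.init y.1) w = y.1
    calc Fin.snoc (Fin.init y.1) w = Fin.snoc (Fin.init y.1) (y.1 (Fin.last (k + 1))) :=
          congrArg _ h.symm
      _ = y.1 := Fin.snoc_init_self _
  right_inv p := by
    obtain ⟨⟨t, ht⟩, ⟨y, hy⟩⟩ := p
    have h2 := hy.2.1
    have h1 : (y (Fin.last k))⁻¹ * w = t := by
      rw [h2, mul_inv_rev, inv_mul_cancel_right]
      exact inv_eq_of_mul_eq_one_left (ht.mul_self hS)
    have h3 : (Fin.snoc (α := fun _ => G) y w (Fin.last k).castSucc)⁻¹ *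
      Fin.snoc (α := fun _ => G) y w (Fin.last (k + 1)) = t := by
      rw [Fin.snoc_castSucc, Fin.snoc_last, h1]
    have key : ∀ (t' : {t : G // IsReflectionOf S t})
        (y' : {y : Fin (k + 1) → G // IsReflectionPath S k (w * t') y}), t'.1 = t → y'.1 = y →
        (⟨t', y'⟩ : Σ t : {t : G // IsReflectionOf S t},
          {y : Fin (k + 1) → G // IsReflectionPath S k (w * t) y}) = ⟨⟨t, ht⟩, ⟨y, hy⟩⟩ := by
      rintro ⟨t', _⟩ ⟨y', _⟩ rfl rfl
      rfl
    exact key _ _ h3 (Fin.init_snoc (α := fun _ => G) w y)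

theorem pathCount_succ [Finite G] [Fintype {t : G // IsReflectionOf S t}]
    (hS : ∀ s ∈ S, s * s = 1) (k : ℕ) (w : G) :
    pathCount S (k + 1) w = ∑ t : {t : G // IsReflectionOf S t}, pathCount S k (w * t) := by
  rw [pathCount, Nat.card_congr (pathEquiv hS k w), Nat.card_sigma]
  rfl

theorem IsReflectionProduct.pathCount_ne_zero [Finite G] {k : ℕ} {w : G}
    (h : IsReflectionProduct S k w) (hS : ∀ s ∈ S, s * s = 1) : pathCount S k w ≠ 0 := by
  classical
  have := Fintype.ofFinite G
  obtain ⟨l, hl, rfl, rfl⟩ := h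
  induction l using List.reverseRecOn with
  | nil => simp [pathCount_zero]
  | append_singleton l t ih =>
    have ht : IsReflectionOf S t := hl t (by simp)
    rw [List.length_append, List.length_singleton, pathCount_succ hS, ← Nat.pos_iff_ne_zero]
    refine Finset.sum_pos' (fun _ _ => Nat.zero_le _) ⟨⟨t, ht⟩, Finset.mem_univ _, ?_⟩
    rw [List.prod_append, List.prod_singleton, mul_assoc, ht.mul_self hS, mul_one]
    exact Nat.pos_of_ne_zero (ih fun u hu => hl u (by simp [hu]))

end Chains

namespace SignedPerm
open Module

theorem refl_apply_eq_self_iff {n : ℕ} {i j : Fin n} (hij : i ≠ j) (ε : ℤˣ) (x : Fin n) :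
    refl i j ε (fun y => ((y : ℕ) : ℚ) + 1) x = ((x : ℕ) : ℚ) + 1 ↔ ¬(x = i ∨ x = j) := by
  have key : ∀ a b : Fin n, a ≠ b → ((ε : ℤ) : ℚ) * (((b : ℕ) : ℚ) + 1) ≠ ((a : ℕ) : ℚ) + 1 := by
    intro a b hab h
    rcases Int.units_eq_one_or ε with rfl | rfl
    · have : ((b : ℕ) : ℚ) = (a : ℕ) := by simpa using h
      exact hab (Fin.ext (by exact_mod_cast this.symm))
    · have h1 : (0 : ℚ) ≤ (a : ℕ) := Nat.cast_nonneg _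
      have h2 : (0 : ℚ) ≤ (b : ℕ) := Nat.cast_nonneg _
      norm_num at h
      linarith
  rw [refl_apply]
  split_ifs with h1 h2
  · subst h1
    simpa using key x j hij
  · subst h2
    simpa using key x i hij.symm
  · simp [h1, h2]

theorem refl_injective {n : ℕ} {i j i' j' : Fin n} {ε ε' : ℤˣ} (hij : i < j) (hij' : i' < j')
    (h : refl i j ε = refl i' j' ε') : i = i' ∧ j = j' ∧ ε = ε' := by
  have h1 : ∀ x, (x = i ∨ x = j) ↔ (x = i' ∨ x = j') := by
    intro x
    rw [← not_iff_not, ← refl_apply_eq_self_iff hij.ne ε, ← refl_apply_eq_self_iff hij'.ne ε', h]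
  have hi := (h1 i).1 (Or.inl rfl)
  have hj := (h1 j).1 (Or.inr rfl)
  have e1 : i = i' := by
    rcases hi with hi | hi
    · exact hi
    · rcases hj with hj | hj <;> omega
  have e2 : j = j' := by
    rcases hj with hj | hj
    · omega
    · exact hj
  subst e1 e2
  refine ⟨rfl, rfl, ?_⟩
  have h2 := congrFun (LinearMap.congr_fun h fun _ => 1) i
  rw [refl_apply, refl_apply, if_pos rfl, if_pos rfl, mul_one, mul_one] at h2
  exact Units.ext (by exact_mod_cast h2)

theorem sum_refl_eq {n : ℕ} (G : Module.End ℚ (Fin n → ℚ) → ℚ) :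
    (∑ i : Fin n, ∑ j : Fin n, ∑ ε : ℤˣ, if i = j then 0 else G (refl i j ε)) =
      2 * ∑ x : Fin n × Fin n × ℤˣ with x.1 < x.2.1, G (refl x.1 x.2.1 x.2.2) := by
  have h1 : ∀ i j : Fin n, (∑ ε : ℤˣ, if i = j then 0 else G (refl i j ε)) =
      (∑ ε : ℤˣ, if i < j then G (refl i j ε) else 0) +
        ∑ ε : ℤˣ, if j < i then G (refl j i ε) else 0 := by
    intro i j
    rw [← Finset.sum_add_distrib]
    refine Finset.sum_congr rfl fun ε _ => ?_
    rcases lt_trichotomy i j with h | h | h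
    · simp [h, h.ne, h.not_gt]
    · simp [h]
    · simp [h, h.ne', h.not_gt, refl_comm i j]
  simp only [h1, Finset.sum_add_distrib]
  rw [Finset.sum_comm (f := fun i j => ∑ ε : ℤˣ, if j < i then G (refl j i ε) else 0), ← two_mul,
    Finset.sum_filter, Fintype.sum_prod_type]
  simp only [Fintype.sum_prod_type]

/-- Reflection paths in a group represented by signed permutations. -/
theorem pathCount_eq_factCount {W : Type*} [Group W] [Finite W] {S : Set W} {n : ℕ}
    (φ : W →* Module.End ℚ (Fin n → ℚ)) (hφ : Function.Injective φ) (hS : ∀ s ∈ S, s * s = 1)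
    (hrefl : ∀ t, IsReflectionOf S t → ∃ i j ε, i ≠ j ∧ φ t = refl i j ε)
    (hex : ∀ i j ε, i ≠ j → ∃ t, IsReflectionOf S t ∧ φ t = refl i j ε) (k : ℕ) (w : W) :
    (pathCount S k w : ℚ) = factCount (Fin n) k (φ w) := by
  classical
  have := Fintype.ofFinite W
  induction k generalizing w with
  | zero =>
    rw [pathCount_zero, factCount]
    have : φ w = 1 ↔ w = 1 := by rw [← hφ.eq_iff, map_one]
    simp [this]
  | succ k ih =>
    rw [pathCount_succ hS, factCount, sum_refl_eq fun t => factCount (Fin n) k (φ w * t)]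
    push_cast
    rw [← mul_assoc, one_div, inv_mul_cancel₀ two_ne_zero, one_mul]
    simp only [ih, map_mul]
    symm
    refine Finset.sum_bij (fun x hx => ⟨(hex x.1 x.2.1 x.2.2 (Finset.mem_filter.1 hx).2.ne).choose,
      (hex x.1 x.2.1 x.2.2 (Finset.mem_filter.1 hx).2.ne).choose_spec.1⟩)
      (fun _ _ => Finset.mem_univ _) ?_ ?_ ?_
    · rintro ⟨i, j, ε⟩ h ⟨i', j', ε'⟩ h' heq
      have h1 := congrArg (fun t : {t : W // IsReflectionOf S t} => φ t) heq
      simp only [(hex i j ε (Finset.mem_filter.1 h).2.ne).choose_spec.2,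
        (hex i' j' ε' (Finset.mem_filter.1 h').2.ne).choose_spec.2] at h1
      obtain ⟨rfl, rfl, rfl⟩ := refl_injective (Finset.mem_filter.1 h).2
        (Finset.mem_filter.1 h').2 h1
      rfl
    · rintro ⟨t, ht⟩ -
      obtain ⟨i, j, ε, hij, h⟩ := hrefl t ht
      rcases lt_or_gt_of_ne hij with h1 | h1
      · refine ⟨(i, j, ε), by simpa using h1, Subtype.ext (hφ ?_)⟩
        rw [h]
        exact (hex i j ε hij).choose_spec.2
      · refine ⟨(j, i, ε), by simpa using h1, Subtype.ext (hφ ?_)⟩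
        exact (hex j i ε hij.symm).choose_spec.2.trans (by rw [h, refl_comm])
    · rintro ⟨i, j, ε⟩ h
      rw [(hex i j ε (Finset.mem_filter.1 h).2.ne).choose_spec.2]

theorem refl_mul_self {ι : Type} [DecidableEq ι] {i j : ι} (hij : i ≠ j) (ε : ℤˣ) :
    refl i j ε * refl i j ε = 1 := by
  have h := sign_mul_self ε
  refine LinearMap.ext fun f => funext fun x => ?_
  rw [Module.End.mul_apply, Module.End.one_apply]
  by_cases h1 : x = i
  · subst h1
    simp [refl_apply, hij.symm, ← mul_assoc, h]
  · by_cases h2 : x = j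
    · subst h2
      simp [refl_apply, h1, ← mul_assoc, h]
    · simp [refl_apply, h1, h2]

/-- The signs used to express `refl p q δ` as a reindexing. -/
def swapSign {ι : Type} [DecidableEq ι] (p q : ι) (δ : ℤˣ) (x : ι) : ℤˣ :=
  if x = p ∨ x = q then δ else 1

theorem reindex_swap {ι : Type} [DecidableEq ι] (p q : ι) (δ : ℤˣ) (f : ι → ℚ) :
    reindex (Equiv.swap p q) (swapSign p q δ) f = refl p q δ f := by
  funext x
  rw [reindex_apply, refl_apply, swapSign, Equiv.swap_apply_def]
  by_cases h1 : x = p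
  · simp [h1]
  · by_cases h2 : x = q
    · subst h2
      simp [h1]
    · simp [h1, h2]

/-- Conjugating a reflection by a reflection. -/
theorem refl_conj {ι : Type} [DecidableEq ι] {p q : ι} (hpq : p ≠ q) (δ : ℤˣ) (i j : ι) (ε : ℤˣ) :
    refl p q δ * refl i j ε * refl p q δ =
      refl (Equiv.swap p q i) (Equiv.swap p q j) (swapSign p q δ i * swapSign p q δ j * ε) := by
  have h : ∀ x, swapSign p q δ (Equiv.swap p q x) = swapSign p q δ x := by
    intro x
    unfold swapSign
    simp only [Equiv.swap_apply_eq_iff, Equiv.swap_apply_left, Equiv.swap_apply_right, or_comm]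
  have hsq : ∀ δ : ℤˣ, δ * δ = 1 := Int.units_mul_self
  refine LinearMap.ext fun f => ?_
  have h1 := reindex_refl (Equiv.swap p q) (swapSign p q δ) (Equiv.swap p q i) (Equiv.swap p q j)
    (swapSign p q δ i * swapSign p q δ j * ε) (refl p q δ f)
  rw [Equiv.swap_apply_self, Equiv.swap_apply_self, reindex_swap, reindex_swap, h, h,
    show ∀ a b : ℤˣ, a * b * (a * b * ε) = (a * a) * (b * b) * ε from fun a b => by
      rw [← mul_assoc, mul_mul_mul_comm],
    hsq, hsq, one_mul, one_mul] at h1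
  rw [Module.End.mul_apply, Module.End.mul_apply, h1, ← Module.End.mul_apply (refl p q δ),
    refl_mul_self hpq, Module.End.one_apply]

theorem refl_conj_one {ι : Type} [DecidableEq ι] {p q : ι} (hpq : p ≠ q) (i j : ι) (ε : ℤˣ) :
    refl p q 1 * refl i j ε * refl p q 1 = refl (Equiv.swap p q i) (Equiv.swap p q j) ε := by
  rw [refl_conj hpq]
  simp [swapSign]

theorem refl_conj_disjoint {ι : Type} [DecidableEq ι] {p q i j : ι} (hpq : p ≠ q) (hip : i ≠ p)
    (hiq : i ≠ q) (hjp : j ≠ p) (hjq : j ≠ q) (δ ε : ℤˣ) :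
    refl p q δ * refl i j ε * refl p q δ = refl i j ε := by
  rw [refl_conj hpq, Equiv.swap_apply_of_ne_of_ne hip hiq, Equiv.swap_apply_of_ne_of_ne hjp hjq]
  simp [swapSign, hip, hiq, hjp, hjq]

theorem refl_braid {ι : Type} [DecidableEq ι] {i j k : ι} (hij : i ≠ j) (hjk : j ≠ k) (hik : i ≠ k)
    (ε δ : ℤˣ) : refl i j ε * refl j k δ * refl i j ε = refl j k δ * refl i j ε * refl j k δ := by
  rw [refl_conj hij, refl_conj hjk, Equiv.swap_apply_right, Equiv.swap_apply_left,
    Equiv.swap_apply_of_ne_of_ne hik.symm hjk.symm, Equiv.swap_apply_of_ne_of_ne hij hik]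
  simp [swapSign, hij, hjk.symm, hik, hik.symm, mul_comm]

end SignedPerm

/-- The defining relations of the Coxeter group of type `D n`, with generators `s 0, …, s (n - 1)`
and the node `0` attached to the node `2`. -/
structure IsTypeDSeq {W : Type*} [Group W] (n : ℕ) (s : ℕ → W) : Prop where
  sq : ∀ i, s i * s i = 1
  comm : ∀ i j, i + 1 < j → 3 ≤ j → s i * s j = s j * s i
  comm_one_zero : s 1 * s 0 = s 0 * s 1
  braid : ∀ i, 1 ≤ i → i + 1 < n → s i * s (i + 1) * s i = s (i + 1) * s i * s (i + 1)
  braid_zero_two : 2 < n → s 0 * s 2 * s 0 = s 2 * s 0 * s 2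

/-- The subgroup generated by `s 0, …, s (k - 1)`. -/
def initialSubgroup {W : Type*} [Group W] (s : ℕ → W) (k : ℕ) : Subgroup W :=
  Subgroup.closure (s '' {i | i < k})

/-- The element of the group of type `D` changing the signs of the coordinates `0` and `m + 1`. -/
def signChange {W : Type*} [Group W] (s : ℕ → W) : ℕ → W
  | 0 => s 0 * s 1
  | m + 1 => s (m + 2) * signChange s m * s (m + 2)

theorem mem_initialSubgroup {W : Type*} [Group W] (s : ℕ → W) {i k : ℕ} (h : i < k) :
    s i ∈ initialSubgroup s k := Subgroup.subset_closure ⟨i, h, rfl⟩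

theorem initialSubgroup_mono {W : Type*} [Group W] (s : ℕ → W) : Monotone (initialSubgroup s) :=
  fun _ _ h => Subgroup.closure_mono (Set.image_mono fun _ hi => lt_of_lt_of_le hi h)

theorem signChange_mem {W : Type*} [Group W] (s : ℕ → W) (m : ℕ) :
    signChange s m ∈ initialSubgroup s (m + 2) := by
  induction m with
  | zero => exact mul_mem (mem_initialSubgroup s (by omega)) (mem_initialSubgroup s (by omega))
  | succ m ih =>
    exact mul_mem (mul_mem (mem_initialSubgroup s (by omega))
      (initialSubgroup_mono s (by omega) ih)) (mem_initialSubgroup s (by omega))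

namespace IsTypeDSeq

variable {W : Type*} [Group W] {n : ℕ} {s : ℕ → W}

theorem sq_mul (hs : IsTypeDSeq n s) (i : ℕ) (x : W) : s i * (s i * x) = x := by
  rw [← mul_assoc, hs.sq, one_mul]

theorem mul_inv_eq (hs : IsTypeDSeq n s) (i : ℕ) : (s i)⁻¹ = s i :=
  inv_eq_of_mul_eq_one_left (hs.sq i)

/-- Induction over an initial subgroup, by right multiplication by generators. -/
theorem initialSubgroup_induction (hs : IsTypeDSeq n s) {k : ℕ} {P : W → Prop} (one : P 1)
    (mul : ∀ w i, i < k → w ∈ initialSubgroup s k → P w → P (w * s i)) {w : W}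
    (hw : w ∈ initialSubgroup s k) : P w := by
  refine Subgroup.closure_induction_right (p := fun w _ => P w) one ?_ ?_ hw
  · rintro x hx _ ⟨i, hi, rfl⟩ h
    exact mul x i hi hx h
  · rintro x hx _ ⟨i, hi, rfl⟩ h
    rw [hs.mul_inv_eq]
    exact mul x i hi hx h

theorem commute_of_mem (hs : IsTypeDSeq n s) {k j : ℕ} (hkj : k < j) (hj : 3 ≤ j) {w : W}
    (hw : w ∈ initialSubgroup s k) : w * s j = s j * w := by
  refine hs.initialSubgroup_induction (P := fun w => w * s j = s j * w) (by simp) ?_ hw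
  intro w i hi _ ih
  rw [mul_assoc, hs.comm i j (by omega) hj, ← mul_assoc, ih, mul_assoc]

theorem signChange_mul (hs : IsTypeDSeq n s) (m : ℕ) (hm : m + 2 < n) (i : ℕ) (hi : i < m + 2) :
    signChange s (m + 1) * s i = s (Equiv.swap 0 1 i) * signChange s (m + 1) := by
  induction m generalizing i with
  | zero =>
    have h2 : signChange s 1 = s 2 * (s 0 * s 1) * s 2 := rfl
    have hb0 := hs.braid_zero_two (by omega)
    have hb1 := hs.braid 1 le_rfl (by omega)
    simp only [Nat.reduceAdd] at hb1
    rw [h2]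
    obtain rfl | rfl : i = 0 ∨ i = 1 := by omega
    · rw [Equiv.swap_apply_left]
      calc s 2 * (s 0 * s 1) * s 2 * s 0 = s 2 * s 1 * (s 0 * s 2 * s 0) := by
            rw [← hs.comm_one_zero]
            simp only [mul_assoc]
        _ = (s 2 * s 1 * s 2) * s 0 * s 2 := by
            rw [hb0]
            simp only [mul_assoc]
        _ = s 1 * (s 2 * (s 1 * s 0) * s 2) := by
            rw [← hb1]
            simp only [mul_assoc]
        _ = _ := by rw [hs.comm_one_zero]
    · rw [Equiv.swap_apply_right]
      calc s 2 * (s 0 * s 1) * s 2 * s 1 = s 2 * s 0 * (s 1 * s 2 * s 1) := by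
            simp only [mul_assoc]
        _ = (s 2 * s 0 * s 2) * s 1 * s 2 := by
            rw [hb1]
            simp only [mul_assoc]
        _ = s 0 * (s 2 * (s 0 * s 1) * s 2) := by
            rw [← hb0]
            simp only [mul_assoc]
  | succ m ih =>
    have h2 : signChange s (m + 1 + 1) = s (m + 3) * signChange s (m + 1) * s (m + 3) := rfl
    by_cases hi' : i < m + 2
    · have hi2 : Equiv.swap 0 1 i < m + 2 := by
        rw [Equiv.swap_apply_def]
        split_ifs <;> omega
      rw [h2, mul_assoc, ← hs.comm i (m + 3) (by omega) (by omega), mul_assoc,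
        ← mul_assoc (signChange s _), ih (by omega) i hi', ← mul_assoc, ← mul_assoc,
        ← hs.comm _ (m + 3) (by omega : Equiv.swap 0 1 i + 1 < m + 3) (by omega)]
      simp only [mul_assoc]
    · obtain rfl : i = m + 2 := by omega
      have h3 : signChange s (m + 1) = s (m + 2) * signChange s m * s (m + 2) := rfl
      have hb := hs.braid (m + 2) (by omega) (by omega)
      have hc := hs.commute_of_mem (by omega : m + 2 < m + 3) (by omega) (signChange_mem s m)
      rw [Equiv.swap_apply_of_ne_of_ne (by omega) (by omega), h2, h3]
      calc _ = s (m + 3) * s (m + 2) * signChange s m * (s (m + 2) * s (m + 2 + 1) * s (m + 2)) := by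
            simp only [mul_assoc]
        _ = s (m + 3) * s (m + 2) * (signChange s m * s (m + 3)) * s (m + 2) * s (m + 3) := by
            rw [hb]
            simp only [mul_assoc]
        _ = (s (m + 2 + 1) * s (m + 2) * s (m + 2 + 1)) * signChange s m * s (m + 2) *
            s (m + 3) := by
            rw [hc]
            simp only [mul_assoc]
        _ = _ := by
            rw [← hb]
            simp only [mul_assoc]

theorem mem_initialSubgroup_two (hs : IsTypeDSeq n s) {w : W} (hw : w ∈ initialSubgroup s 2) :
    w = 1 ∨ w = s 0 ∨ w = s 1 ∨ w = s 0 * s 1 := by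
  refine hs.initialSubgroup_induction (P := fun w => w = 1 ∨ w = s 0 ∨ w = s 1 ∨ w = s 0 * s 1)
    (by simp) ?_ hw
  intro w i hi _ ih
  obtain rfl | rfl : i = 0 ∨ i = 1 := by omega
  · rcases ih with rfl | rfl | rfl | rfl
    · simp
    · simp [hs.sq]
    · simp [hs.comm_one_zero]
    · simp [hs.comm_one_zero, mul_assoc, hs.sq_mul]
  · rcases ih with rfl | rfl | rfl | rfl
    · simp
    · simp
    · simp [hs.sq]
    · simp [mul_assoc, hs.sq]

/-- The elements of type `D (m + 3)` reached by the double cosets of type `D (m + 2)`. -/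
def InCosets (s : ℕ → W) (m : ℕ) (w : W) : Prop :=
  w ∈ initialSubgroup s (m + 2) ∨
    (∃ a ∈ initialSubgroup s (m + 2), ∃ b ∈ initialSubgroup s (m + 2), w = a * s (m + 2) * b) ∨
    ∃ a ∈ initialSubgroup s (m + 2), w = a * signChange s (m + 1)

theorem inCosets_of_conj (hs : IsTypeDSeq n s) (m : ℕ) (hm : m + 2 < n)
    (hconj : ∀ b ∈ initialSubgroup s (m + 2), InCosets s m (s (m + 2) * b * s (m + 2))) {w : W}
    (hw : w ∈ initialSubgroup s (m + 3)) : InCosets s m w := by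
  refine hs.initialSubgroup_induction (P := InCosets s m) (Or.inl (one_mem _)) ?_ hw
  intro w i hi _ ih
  by_cases hi' : i < m + 2
  · have hmem := mem_initialSubgroup s hi'
    rcases ih with h | ⟨a, ha, b, hb, rfl⟩ | ⟨a, ha, rfl⟩
    · exact Or.inl (mul_mem h hmem)
    · exact Or.inr (Or.inl ⟨a, ha, b * s i, mul_mem hb hmem, mul_assoc _ _ _⟩)
    · refine Or.inr (Or.inr ⟨a * s (Equiv.swap 0 1 i), mul_mem ha (mem_initialSubgroup s ?_), ?_⟩)
      · rw [Equiv.swap_apply_def]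
        split_ifs <;> omega
      · rw [mul_assoc, hs.signChange_mul m hm i hi', mul_assoc]
  · obtain rfl : i = m + 2 := by omega
    rcases ih with h | ⟨a, ha, b, hb, rfl⟩ | ⟨a, ha, rfl⟩
    · exact Or.inr (Or.inl ⟨w, h, 1, one_mem _, by simp⟩)
    · rw [show a * s (m + 2) * b * s (m + 2) = a * (s (m + 2) * b * s (m + 2)) by
        simp only [mul_assoc]]
      rcases hconj b hb with h | ⟨a', ha', b', hb', h⟩ | ⟨a', ha', h⟩
      · exact Or.inl (mul_mem ha h)
      · exact Or.inr (Or.inl ⟨a * a', mul_mem ha ha', b', hb', by simp only [h, mul_assoc]⟩)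
      · exact Or.inr (Or.inr ⟨a * a', mul_mem ha ha', by simp only [h, mul_assoc]⟩)
    · refine Or.inr (Or.inl ⟨a, ha, signChange s m, signChange_mem s m, ?_⟩)
      simp only [signChange, mul_assoc, hs.sq, mul_one]

theorem inCosets (hs : IsTypeDSeq n s) (m : ℕ) (hm : m + 2 < n) {w : W}
    (hw : w ∈ initialSubgroup s (m + 3)) : InCosets s m w := by
  induction m generalizing w with
  | zero =>
    refine hs.inCosets_of_conj 0 hm (fun b hb => ?_) hw
    have h0 := mem_initialSubgroup s (show 0 < 2 by omega)
    have h1 := mem_initialSubgroup s (show 1 < 2 by omega)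
    rcases hs.mem_initialSubgroup_two hb with rfl | rfl | rfl | rfl
    · exact Or.inl (by simp [hs.sq, one_mem])
    · exact Or.inr (Or.inl ⟨s 0, h0, s 0, h0, (hs.braid_zero_two hm).symm⟩)
    · exact Or.inr (Or.inl ⟨s 1, h1, s 1, h1, (hs.braid 1 le_rfl hm).symm⟩)
    · exact Or.inr (Or.inr ⟨1, one_mem _, (one_mul _).symm⟩)
  | succ m ih =>
    refine hs.inCosets_of_conj (m + 1) hm (fun b hb => ?_) hw
    have hc := fun a => hs.commute_of_mem (w := a) (by omega : m + 2 < m + 3) (by omega)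
    have hmono := initialSubgroup_mono s (by omega : m + 2 ≤ m + 1 + 2)
    have hmem := mem_initialSubgroup s (by omega : m + 2 < m + 1 + 2)
    have hb3 := hs.braid (m + 2) (by omega) hm
    change InCosets s (m + 1) (s (m + 3) * b * s (m + 3))
    rcases ih (by omega) hb with h | ⟨a, ha, b, hb', rfl⟩ | ⟨a, ha, rfl⟩
    · rw [mul_assoc, hc b h, hs.sq_mul]
      exact Or.inl (hmono h)
    · refine Or.inr (Or.inl ⟨a * s (m + 2), mul_mem (hmono ha) hmem, s (m + 2) * b,
        mul_mem hmem (hmono hb'), ?_⟩)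
      calc _ = s (m + 3) * a * s (m + 2) * (b * s (m + 3)) := by simp only [mul_assoc]
        _ = a * (s (m + 2 + 1) * s (m + 2) * s (m + 2 + 1)) * b := by
          rw [hc b hb', ← hc a ha]
          simp only [mul_assoc]
        _ = _ := by
          rw [← hb3]
          simp only [mul_assoc]
    · refine Or.inr (Or.inr ⟨a, hmono ha, ?_⟩)
      rw [← mul_assoc, ← hc a ha]
      simp only [signChange, mul_assoc]

/-- The product of `s 0, …, s (k + 1)` in any order is conjugate to the product in increasing order. -/
theorem exists_conj_prod (hs : IsTypeDSeq n s) (k : ℕ) (l : List ℕ)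
    (hl : l.Perm (List.range (k + 2))) :
    ∃ g ∈ initialSubgroup s (k + 1), g * s (k + 2) = s (k + 2) * g ∧
      (l.map s).prod = g * ((List.range (k + 2)).map s).prod * g⁻¹ := by
  induction k generalizing l with
  | zero =>
    refine ⟨1, one_mem _, by simp, ?_⟩
    have h := List.mem_permutations.2 hl
    have h2 : l = [0, 1] ∨ l = [1, 0] := by
      rw [show (List.range (0 + 2)) = [0, 1] from rfl] at h
      simpa [List.permutations, List.permutationsAux, List.permutationsAux.rec,
        List.permutationsAux2] using h
    rcases h2 with rfl | rfl
    · simp [List.range_succ]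
    · simp [List.range_succ, hs.comm_one_zero]
  | succ k ih =>
    have hmem : k + 2 ∈ l := hl.mem_iff.2 (by simp)
    obtain ⟨a, b, rfl⟩ := List.append_of_mem hmem
    have hperm : (b ++ a).Perm (List.range (k + 2)) := by
      refine List.Perm.cons_inv (a := k + 2) ?_
      refine ((List.perm_append_comm.cons _).trans List.perm_middle.symm).trans (hl.trans ?_)
      rw [show k + 1 + 2 = k + 2 + 1 from rfl, List.range_succ]
      exact List.perm_append_singleton _ _
    obtain ⟨g, hg, hcomm, h⟩ := ih _ hperm
    have hb : (b.map s).prod ∈ initialSubgroup s (k + 2) := by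
      refine Subgroup.list_prod_mem _ fun x hx => ?_
      obtain ⟨i, hi, rfl⟩ := List.mem_map.1 hx
      exact mem_initialSubgroup s (List.mem_range.1 (hperm.mem_iff.1 (List.mem_append_left _ hi)))
    have hmem : (b.map s).prod⁻¹ * g ∈ initialSubgroup s (k + 2) :=
      mul_mem (inv_mem hb) (initialSubgroup_mono s (by omega) hg)
    refine ⟨_, hmem, hs.commute_of_mem (by omega) (by omega) hmem, ?_⟩
    have hcomm' : g⁻¹ * s (k + 2) = s (k + 2) * g⁻¹ := by
      rw [inv_mul_eq_iff_eq_mul, ← mul_assoc, hcomm, mul_inv_cancel_right]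
    rw [show k + 1 + 2 = k + 2 + 1 from rfl, List.range_succ]
    simp only [List.map_append, List.map_cons, List.prod_append, List.prod_cons, List.map_nil,
      List.prod_nil, mul_one] at h ⊢
    calc _ = (b.map s).prod⁻¹ * ((b.map s).prod * (a.map s).prod) * s (k + 2) * (b.map s).prod := by
          group
      _ = (b.map s).prod⁻¹ * g * ((List.range (k + 2)).map s).prod * (g⁻¹ * s (k + 2)) *
          (b.map s).prod := by
          rw [h]
          group
      _ = _ := by
          rw [hcomm']
          group

end IsTypeDSeq

namespace IsTypeDSeq
open SignedPerm Module

/-- The action of a group with generators `s 0, s 1, …` by signed permutations, with `s 0` acting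
as `e 0 ↦ -e 1` and `s (i + 1)` exchanging `e i` and `e (i + 1)`. -/
structure IsSignedRep {W : Type*} [Group W] {n : ℕ} (s : ℕ → W)
    (φ : W →* End ℚ (Fin n → ℚ)) : Prop where
  zero : ∀ h : 1 < n, φ (s 0) = refl ⟨0, by omega⟩ ⟨1, h⟩ (-1)
  succ : ∀ i, ∀ h : i + 1 < n, φ (s (i + 1)) = refl ⟨i, by omega⟩ ⟨i + 1, h⟩ 1

/-- The standard basis vector `e a`. -/
def coordVec (n a : ℕ) : Fin n → ℚ := fun x => if (x : ℕ) = a then 1 else 0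

variable {W : Type*} [Group W] {n : ℕ} {s : ℕ → W} {φ : W →* End ℚ (Fin n → ℚ)}

theorem IsSignedRep.zero_apply (h : IsSignedRep s φ) (hn : 1 < n) (f : Fin n → ℚ) (x : Fin n) :
    φ (s 0) f x = if (x : ℕ) = 0 then -f ⟨1, hn⟩ else
      if (x : ℕ) = 1 then -f ⟨0, by omega⟩ else f x := by
  rw [h.zero hn, refl_apply]
  simp [Fin.ext_iff]

theorem IsSignedRep.succ_apply (h : IsSignedRep s φ) (i : ℕ) (hi : i + 1 < n) (f : Fin n → ℚ)
    (x : Fin n) : φ (s (i + 1)) f x = if (x : ℕ) = i then f ⟨i + 1, hi⟩ else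
      if (x : ℕ) = i + 1 then f ⟨i, by omega⟩ else f x := by
  rw [h.succ i hi, refl_apply]
  simp [Fin.ext_iff]

theorem IsSignedRep.apply_coordVec (h : IsSignedRep s φ) (hn : 1 < n) {i a : ℕ} (hi : i < n) (hia : i < a)
    (ha : 2 ≤ a) : φ (s i) (coordVec n a) = coordVec n a := by
  funext x
  cases i with
  | zero =>
    rw [h.zero_apply hn]
    simp only [coordVec]
    split_ifs <;> first | contradiction | omega | simp
  | succ i =>
    rw [h.succ_apply i hi]
    simp only [coordVec]
    split_ifs <;> first | contradiction | omega | simp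

theorem IsSignedRep.succ_coordVec (h : IsSignedRep s φ) (i : ℕ) (hi : i + 1 < n) :
    φ (s (i + 1)) (coordVec n (i + 1)) = coordVec n i := by
  funext x
  rw [h.succ_apply i hi]
  simp only [coordVec]
  split_ifs <;> first | contradiction | omega | simp

theorem IsSignedRep.succ_coordVec' (h : IsSignedRep s φ) (i : ℕ) (hi : i + 1 < n) :
    φ (s (i + 1)) (coordVec n i) = coordVec n (i + 1) := by
  funext x
  rw [h.succ_apply i hi]
  simp only [coordVec]
  split_ifs <;> first | contradiction | omega | simp

theorem IsSignedRep.zero_coordVec (h : IsSignedRep s φ) (hn : 1 < n) :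
    φ (s 0) (coordVec n 0) = -coordVec n 1 := by
  funext x
  rw [h.zero_apply hn]
  simp only [coordVec, Pi.neg_apply]
  split_ifs <;> first | contradiction | omega | simp

theorem IsSignedRep.zero_coordVec' (h : IsSignedRep s φ) (hn : 1 < n) :
    φ (s 0) (coordVec n 1) = -coordVec n 0 := by
  funext x
  rw [h.zero_apply hn]
  simp only [coordVec, Pi.neg_apply]
  split_ifs <;> first | contradiction | omega | simp

theorem coordVec_ne {a b : ℕ} (ha : a < n) (hab : a ≠ b) : coordVec n a ≠ coordVec n b := by
  intro h
  simpa [coordVec, hab] using congrFun h ⟨a, ha⟩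

theorem coordVec_ne_neg {a : ℕ} (b : ℕ) (ha : a < n) : -coordVec n b ≠ coordVec n a := by
  intro h
  have := congrFun h ⟨a, ha⟩
  simp only [coordVec, Pi.neg_apply] at this
  split_ifs at this <;> norm_num at this

theorem IsSignedRep.fix_coordVec (hs : IsTypeDSeq n s) (h : IsSignedRep s φ) (hn : 1 < n) {k a : ℕ} (hk : k ≤ n)
    (hka : k ≤ a) (ha : 2 ≤ a) {w : W} (hw : w ∈ initialSubgroup s k) :
    φ w (coordVec n a) = coordVec n a := by
  refine hs.initialSubgroup_induction (P := fun w => φ w (coordVec n a) = coordVec n a)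
    (by simp) ?_ hw
  intro w i hi _ ih
  rw [map_mul, Module.End.mul_apply, h.apply_coordVec hn (by omega) (by omega) ha, ih]

theorem IsSignedRep.signChange_coordVec (h : IsSignedRep s φ) (m : ℕ)
    (hm : m + 1 < n) :
    φ (signChange s m) (coordVec n (m + 1)) = -coordVec n (m + 1) := by
  induction m with
  | zero =>
    rw [signChange, map_mul, Module.End.mul_apply, h.succ_coordVec 0 hm, h.zero_coordVec hm]
  | succ m ih =>
    rw [signChange, map_mul, map_mul, Module.End.mul_apply, Module.End.mul_apply,
      h.succ_coordVec (m + 1) hm, ih (by omega), map_neg, h.succ_coordVec' (m + 1) hm]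

theorem IsSignedRep.eq_one (hs : IsTypeDSeq n s) (h : IsSignedRep s φ) (m : ℕ) (hm : m + 2 ≤ n)
    {w : W} (hw : w ∈ initialSubgroup s (m + 2)) (hφ : φ w = 1) : w = 1 := by
  induction m generalizing w with
  | zero =>
    have h1 : φ w (coordVec n 1) = coordVec n 1 := by rw [hφ, Module.End.one_apply]
    rcases hs.mem_initialSubgroup_two hw with rfl | rfl | rfl | rfl
    · rfl
    · rw [h.zero_coordVec' (by omega)] at h1
      exact absurd h1 (coordVec_ne_neg 0 (by omega))
    · rw [h.succ_coordVec 0 (by omega)] at h1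
      exact absurd h1 (coordVec_ne (by omega) (by omega))
    · rw [map_mul, Module.End.mul_apply, h.succ_coordVec 0 (by omega),
        h.zero_coordVec (by omega)] at h1
      exact absurd h1 (coordVec_ne_neg 1 (by omega))
  | succ m ih =>
    have hfix := fun {w} => h.fix_coordVec hs (by omega) (w := w) (by omega : m + 2 ≤ n) le_rfl (by omega)
    rcases hs.inCosets m (by omega) hw with hw | ⟨a, ha, b, hb, rfl⟩ | ⟨a, ha, rfl⟩
    · exact ih (by omega) hw hφ
    · have h1 := congrArg (fun g => φ g (coordVec n (m + 2)))
        (show s (m + 2) * b = a⁻¹ * (a * s (m + 2) * b) by group)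
      simp only [map_mul φ a⁻¹, hφ, mul_one] at h1
      rw [map_mul, Module.End.mul_apply, hfix hb, hfix (inv_mem ha),
        h.succ_coordVec (m + 1) (by omega)] at h1
      exact absurd h1 (coordVec_ne (by omega) (by omega))
    · have h1 := congrArg (fun g => φ g (coordVec n (m + 2)))
        (show signChange s (m + 1) = a⁻¹ * (a * signChange s (m + 1)) by group)
      simp only [map_mul φ a⁻¹, hφ, mul_one] at h1
      rw [hfix (inv_mem ha), h.signChange_coordVec (m + 1) (by omega)] at h1
      exact absurd h1 (coordVec_ne_neg _ (by omega))

theorem IsSignedRep.gen (h : IsSignedRep s φ) (hn : 1 < n) {i : ℕ} (hi : i < n) :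
    ∃ p q δ, p ≠ q ∧ φ (s i) = refl p q δ := by
  cases i with
  | zero => exact ⟨_, _, _, by simp, h.zero hn⟩
  | succ i => exact ⟨_, _, _, by simp, h.succ i hi⟩

theorem IsSignedRep.gen_injective (h : IsSignedRep s φ) (hn : 1 < n) {i j : ℕ} (hi : i < n)
    (hj : j < n) (hij : s i = s j) : i = j := by
  have hij' := congrArg φ hij
  rcases i with _ | i <;> rcases j with _ | j
  · rfl
  · rw [h.zero hn, h.succ j hj] at hij'
    exact absurd (refl_injective (by simp) (by simp) hij').2.2 (by decide)
  · rw [h.zero hn, h.succ i hi] at hij'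
    exact absurd (refl_injective (by simp) (by simp) hij').2.2 (by decide)
  · rw [h.succ i hi, h.succ j hj] at hij'
    exact congrArg (· + 1) (congrArg Fin.val (refl_injective (by simp) (by simp) hij').1)

/-- Reflections act as signed transpositions. -/
theorem IsSignedRep.exists_refl (hs : IsTypeDSeq n s) (h : IsSignedRep s φ) (hn : 1 < n)
    (htop : initialSubgroup s n = ⊤) {t : W} (ht : IsReflectionOf (s '' {i | i < n}) t) :
    ∃ i j ε, i ≠ j ∧ φ t = refl i j ε := by
  have key : ∀ g : W, ∀ (t : W) (i j : Fin n) (ε : ℤˣ), i ≠ j → φ t = refl i j ε →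
      ∃ i j ε, i ≠ j ∧ φ (g * t * g⁻¹) = refl i j ε := by
    intro g
    refine hs.initialSubgroup_induction (P := fun g => ∀ (t : W) (i j : Fin n) (ε : ℤˣ), i ≠ j →
      φ t = refl i j ε → ∃ i j ε, i ≠ j ∧ φ (g * t * g⁻¹) = refl i j ε)
      (fun t i j ε hij ht => ⟨i, j, ε, hij, by simpa using ht⟩) ?_
      (htop ▸ Subgroup.mem_top g : g ∈ initialSubgroup s n)
    intro w k hk _ ih t i j ε hij ht
    obtain ⟨p, q, δ, hpq, hk⟩ := h.gen hn hk
    rw [mul_inv_rev, hs.mul_inv_eq,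
      show w * s k * t * (s k * w⁻¹) = w * (s k * t * s k) * w⁻¹ by simp only [mul_assoc]]
    exact ih _ _ _ _ ((Equiv.swap p q).injective.ne hij)
      (by rw [map_mul, map_mul, ht, hk, refl_conj hpq])
  obtain ⟨g, _, ⟨i, hi, rfl⟩, rfl⟩ := ht
  obtain ⟨p, q, δ, hpq, hk⟩ := h.gen hn hi
  exact key g _ _ _ _ hpq hk

theorem IsSignedRep.exists_reflection (hs : IsTypeDSeq n s) (h : IsSignedRep s φ)
    (i j : Fin n) (ε : ℤˣ) (hij : i ≠ j) :
    ∃ t, IsReflectionOf (s '' {i | i < n}) t ∧ φ t = refl i j ε := by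
  have hconj : ∀ t k, ∀ hk : k + 1 < n, IsReflectionOf (s '' {i | i < n}) t →
      ∀ i j ε, φ t = refl i j ε → ∃ t, IsReflectionOf (s '' {i | i < n}) t ∧
        φ t = refl (Equiv.swap ⟨k, by omega⟩ ⟨k + 1, hk⟩ i)
          (Equiv.swap ⟨k, by omega⟩ ⟨k + 1, hk⟩ j) ε := by
    intro t k hk ht i j ε he
    refine ⟨s (k + 1) * t * (s (k + 1))⁻¹, ht.conj _, ?_⟩
    rw [hs.mul_inv_eq, map_mul, map_mul, h.succ k hk, he, refl_conj_one (by simp)]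
  have hsucc : ∀ i, ∀ hi : i + 1 < n, ∃ t, IsReflectionOf (s '' {i | i < n}) t ∧
      φ t = refl ⟨i, by omega⟩ ⟨i + 1, hi⟩ ε := by
    rcases Int.units_eq_one_or ε with rfl | rfl
    · exact fun i hi => ⟨s (i + 1), ⟨1, s (i + 1), ⟨i + 1, hi, rfl⟩, by simp⟩, h.succ i hi⟩
    · intro i
      induction i with
      | zero => exact fun hi => ⟨s 0, ⟨1, s 0, ⟨0, by simp; omega, rfl⟩, by simp⟩, h.zero hi⟩
      | succ i ih =>
        intro hi
        obtain ⟨t, ht, he⟩ := ih (by omega)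
        obtain ⟨t, ht, he⟩ := hconj t (i + 1) hi ht _ _ _ he
        obtain ⟨t, ht, he⟩ := hconj t i (by omega) ht _ _ _ he
        refine ⟨t, ht, he.trans ?_⟩
        congr 1 <;> simp [Equiv.swap_apply_def, Fin.ext_iff] <;> omega
  have hlt : ∀ d i, ∀ hi : i + 1 + d < n, ∃ t, IsReflectionOf (s '' {i | i < n}) t ∧
      φ t = refl ⟨i, by omega⟩ ⟨i + 1 + d, hi⟩ ε := by
    intro d i
    induction d with
    | zero => exact hsucc i
    | succ d ih =>
      intro hi
      obtain ⟨t, ht, he⟩ := ih (by omega)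
      obtain ⟨t, ht, he⟩ := hconj t (i + 1 + d) hi ht _ _ _ he
      refine ⟨t, ht, he.trans ?_⟩
      congr 1
      · refine Equiv.swap_apply_of_ne_of_ne ?_ ?_ <;> simp [Fin.ext_iff] <;> omega
      · exact Equiv.swap_apply_left _ _
  have hlt' : ∀ i j : Fin n, i < j → ∃ t, IsReflectionOf (s '' {i | i < n}) t ∧
      φ t = refl i j ε := by
    rintro ⟨i, hi⟩ ⟨j, hj⟩ hij
    obtain ⟨d, rfl⟩ := Nat.exists_eq_add_of_le (Nat.succ_le_of_lt hij)
    exact hlt d i hj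
  rcases lt_or_gt_of_ne hij with h1 | h1
  · exact hlt' i j h1
  · rw [refl_comm]
    exact hlt' j i h1

theorem IsSignedRep.prod_range_apply (h : IsSignedRep s φ) (k : ℕ) (hk : k + 1 < n)
    (f : Fin n → ℚ) (x : Fin n) :
    φ ((List.range (k + 2)).map s).prod f x = if (x : ℕ) = 0 then -f x else
      if (x : ℕ) = 1 then -f ⟨k + 1, hk⟩ else if (x : ℕ) < k + 2 then f ⟨x - 1, by omega⟩
      else f x := by
  induction k generalizing f with
  | zero =>
    have hr : ((List.range (0 + 2)).map s).prod = s 0 * s (0 + 1) := by simp [List.range_succ]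
    rw [hr, map_mul, Module.End.mul_apply, h.zero_apply hk]
    simp only [h.succ_apply 0 hk]
    split_ifs with h1 h2 h3
    all_goals first
      | contradiction
      | omega
      | rfl
      | (congr 2; refine Fin.ext ?_; simp only []; omega)
  | succ k ih =>
    rw [show k + 1 + 2 = k + 2 + 1 from rfl, List.range_succ, List.map_append, List.prod_append,
      map_mul, Module.End.mul_apply, ih (by omega)]
    simp only [List.map_cons, List.map_nil, List.prod_cons, List.prod_nil, mul_one,
      h.succ_apply (k + 1) hk]
    split_ifs
    all_goals first
      | omega
      | rfl
      | (congr 2; omega)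

end IsTypeDSeq

namespace IsTypeDSeq
open SignedPerm Module

variable {W : Type*} [Group W] {n : ℕ} {s : ℕ → W}

/-- The coordinates of the signed permutation `s 0 ⋯ s (k + 1)` in cyclic order. -/
noncomputable def cycEquiv (m : ℕ) : Fin m ⊕ Fin 1 ≃ Fin (m + 1) :=
  Equiv.ofBijective
    (Sum.elim (fun x => ⟨m - x, by omega⟩) fun _ => 0)
    ((Fintype.bijective_iff_injective_and_card _).2 ⟨by
      rintro (x | x) (y | y) h
      · have := congrArg Fin.val h
        simp only [Sum.elim_inl] at this
        exact congrArg Sum.inl (by omega)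
      · have := congrArg Fin.val h
        simp at this
        omega
      · have := congrArg Fin.val h
        simp at this
        omega
      · exact congrArg Sum.inr (Subsingleton.elim _ _), by simp⟩)

theorem cycEquiv_inl (m : ℕ) (x : Fin m) : cycEquiv m (Sum.inl x) = ⟨m - x, by omega⟩ := rfl

theorem cycEquiv_inr (m : ℕ) (x : Fin 1) : cycEquiv m (Sum.inr x) = 0 := rfl

theorem IsSignedRep.factCount_prod_range {k : ℕ} {φ : W →* End ℚ (Fin (k + 2) → ℚ)}
    (h : IsSignedRep s φ) (l : ℕ) :
    factCount (Fin (k + 2)) l (φ ((List.range (k + 2)).map s).prod) =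
      factCount (Fin (k + 1) ⊕ Fin 1) l (blockSum (cyc (k + 1) (-1)) (-1)) := by
  symm
  refine factCount_reindex (cycEquiv (k + 1)) (fun _ => 1) l _ _ fun f => ?_
  funext x
  rcases x with x | x
  · rw [reindex_apply, cycEquiv_inl, h.prod_range_apply k (by omega), blockSum_apply_inl, cyc_apply]
    simp only [reindex_apply, cycEquiv_inl, Units.val_one, Int.cast_one, one_mul]
    by_cases hx : (x : ℕ) + 1 < k + 1
    · rw [if_neg (by omega), if_neg (by omega), if_pos (by omega), dif_pos hx]
      exact congrArg f (Fin.ext (by simp only []; omega))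
    · rw [if_neg (by omega), if_pos (by omega), dif_neg hx]
      simp
  · rw [reindex_apply, cycEquiv_inr, h.prod_range_apply k (by omega), blockSum_apply_inr]
    simp [reindex_apply, cycEquiv_inr]

/-- Maximal chains for a type `D` group acting by signed permutations. -/
theorem IsSignedRep.maxChainCount_eq [Finite W] {k : ℕ} (hs : IsTypeDSeq (k + 2) s)
    {φ : W →* End ℚ (Fin (k + 2) → ℚ)} (h : IsSignedRep s φ)
    (htop : initialSubgroup s (k + 2) = ⊤) (l : List ℕ) (hl : l.Perm (List.range (k + 2))) :
    maxChainCount (s '' {i | i < k + 2}) (l.map s).prod (k + 2) = 2 * (k + 1) ^ (k + 2) := by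
  set S := s '' {i | i < k + 2} with hSdef
  have hsq : ∀ t ∈ S, t * t = 1 := by
    rintro _ ⟨i, _, rfl⟩
    exact hs.sq i
  have hinj : Function.Injective φ := by
    rw [injective_iff_map_eq_one]
    exact fun w hw => h.eq_one hs k le_rfl (htop ▸ Subgroup.mem_top w) hw
  have hcount : ∀ j, (pathCount S j (l.map s).prod : ℚ) =
      factCount (Fin (k + 1) ⊕ Fin 1) j (blockSum (cyc (k + 1) (-1)) (-1)) := by
    intro j
    obtain ⟨g, _, _, hg⟩ := hs.exists_conj_prod k l hl
    rw [hg, pathCount_conj, pathCount_eq_factCount φ hinj hsq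
      (fun t => h.exists_refl hs (by omega) htop) (h.exists_reflection hs),
      h.factCount_prod_range]
  have hprod : IsReflectionProduct S (k + 2) (l.map s).prod := by
    refine ⟨l.map s, fun t ht => ?_, by simp [hl.length_eq], rfl⟩
    obtain ⟨i, hi, rfl⟩ := List.mem_map.1 ht
    exact ⟨1, s i, ⟨i, List.mem_range.1 (hl.mem_iff.1 hi), rfl⟩, by simp⟩
  have hlen : absLength S (l.map s).prod = k + 2 := by
    refine le_antisymm hprod.absLength_le ?_
    have h1 := hprod.absLength.pathCount_ne_zero hsq
    have h2 := card_le_of_factCount_ne_zero _ _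
      (hcount _ ▸ Nat.cast_ne_zero.2 h1 : factCount _ (absLength S (l.map s).prod) _ ≠ 0)
    rw [fixed_blockSum_cyc_neg_one] at h2
    simp only [Fintype.card_sum, Fintype.card_fin] at h2
    omega
  rw [maxChainCount_eq_pathCount hlen]
  have h3 := (hcount (k + 2)).trans (coxCount_eq k)
  exact_mod_cast h3

end IsTypeDSeq

theorem mul_comm_of_mul_pow_two {G : Type*} [Group G] {a b : G} (ha : a * a = 1) (hb : b * b = 1)
    (h : (a * b) ^ 2 = 1) : a * b = b * a := by
  rw [pow_two, mul_eq_one_iff_eq_inv, mul_inv_rev, inv_eq_of_mul_eq_one_left ha,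
    inv_eq_of_mul_eq_one_left hb] at h
  exact h

theorem braid_of_mul_pow_three {G : Type*} [Group G] {a b : G} (ha : a * a = 1) (hb : b * b = 1)
    (h : (a * b) ^ 3 = 1) : a * b * a = b * a * b := by
  have h' : a * b * a * (b * a * b) = 1 := by
    rw [← h, pow_three]
    simp only [mul_assoc]
  rw [mul_eq_one_iff_eq_inv, mul_inv_rev, mul_inv_rev, inv_eq_of_mul_eq_one_left ha,
    inv_eq_of_mul_eq_one_left hb, ← mul_assoc] at h'
  exact h'

theorem mul_pow_two_of_conj {G : Type*} [Monoid G] {a b : G} (hb : b * b = 1)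
    (h : a * b * a = b) : (a * b) ^ 2 = 1 := by
  rw [pow_two, ← mul_assoc, h, hb]

theorem mul_pow_three_of_braid {G : Type*} [Monoid G] {a b : G} (ha : a * a = 1) (hb : b * b = 1)
    (h : a * b * a = b * a * b) : (a * b) ^ 3 = 1 := by
  calc (a * b) ^ 3 = a * b * a * (b * a * b) := by
        rw [pow_three]
        simp only [mul_assoc]
    _ = a * b * (a * a) * b * a := by
        rw [← h]
        simp only [mul_assoc]
    _ = 1 := by rw [ha, mul_one, mul_assoc a, hb, mul_one, ha]

namespace SignedPerm

/-- The simple reflections of type `D n` as signed permutations. -/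
def typeDGen (n : ℕ) (hn : 2 ≤ n) (i : Fin n) : Module.End ℚ (Fin n → ℚ) :=
  if (i : ℕ) = 0 then refl ⟨0, by omega⟩ ⟨1, by omega⟩ (-1) else refl ⟨i - 1, by omega⟩ i 1

theorem typeDGen_mul_self (n : ℕ) (hn : 2 ≤ n) (i : Fin n) :
    typeDGen n hn i * typeDGen n hn i = 1 := by
  unfold typeDGen
  split_ifs
  · exact refl_mul_self (by simp) _
  · exact refl_mul_self (by simp only [ne_eq, Fin.ext_iff]; omega) _

/-- The Coxeter matrix entries of type `D`. -/
def typeDEntry {n : ℕ} (i j : Fin n) : ℕ :=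
  if i = j then 1
  else if (((i : ℕ) + 1 = (j : ℕ) ∨ (j : ℕ) + 1 = (i : ℕ)) ∧ (i : ℕ) ≠ 0 ∧ (j : ℕ) ≠ 0)
      ∨ ((i : ℕ) = 0 ∧ (j : ℕ) = 2) ∨ ((j : ℕ) = 0 ∧ (i : ℕ) = 2) then 3
  else 2

theorem typeDEntry_comm {n : ℕ} (i j : Fin n) : typeDEntry i j = typeDEntry j i := by
  unfold typeDEntry
  split_ifs <;> omega

theorem typeDGen_pow (n : ℕ) (hn : 2 ≤ n) (i j : Fin n) :
    (typeDGen n hn i * typeDGen n hn j) ^ typeDEntry i j = 1 := by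
  wlog hij : i ≤ j generalizing i j
  · have h := mul_pow_mul (typeDGen n hn i) (typeDGen n hn j) (typeDEntry i j)
    have h' := this j i (le_of_not_ge hij)
    rw [typeDEntry_comm, h', mul_one] at h
    calc _ = (typeDGen n hn i * typeDGen n hn j) ^ typeDEntry j i *
          (typeDGen n hn i * typeDGen n hn i) := by
          rw [typeDGen_mul_self, mul_one, typeDEntry_comm]
      _ = 1 := by rw [← mul_assoc, h, typeDGen_mul_self]
  have hsq := typeDGen_mul_self n hn
  rcases hij.eq_or_lt with rfl | hij
  · simp [typeDEntry, hsq]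
  have hij' : (i : ℕ) < j := hij
  by_cases h3 : ((i : ℕ) + 1 = j ∧ (i : ℕ) ≠ 0) ∨ ((i : ℕ) = 0 ∧ (j : ℕ) = 2)
  · have he : typeDEntry i j = 3 := by
      unfold typeDEntry
      split_ifs <;> omega
    rw [he]
    refine mul_pow_three_of_braid (hsq i) (hsq j) ?_
    unfold typeDGen
    rcases h3 with ⟨h1, h2⟩ | ⟨h1, h2⟩
    · rw [if_neg h2, if_neg (by omega)]
      have h5 : (⟨j - 1, by omega⟩ : Fin n) = i := Fin.ext (by simp only []; omega)
      rw [h5]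
      refine refl_braid ?_ ?_ ?_ _ _ <;> simp only [ne_eq, Fin.ext_iff] <;> omega
    · rw [if_pos h1, if_neg (by omega)]
      have h5 : (⟨j - 1, by omega⟩ : Fin n) = ⟨1, by omega⟩ := Fin.ext (by simp only []; omega)
      rw [h5]
      refine refl_braid ?_ ?_ ?_ _ _ <;> simp only [ne_eq, Fin.ext_iff] <;> omega
  · have he : typeDEntry i j = 2 := by
      unfold typeDEntry
      split_ifs <;> omega
    rw [he]
    refine mul_pow_two_of_conj (hsq j) ?_
    unfold typeDGen
    by_cases h1 : (j : ℕ) = 1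
    · rw [if_pos (by omega), if_neg (by omega), refl_conj (by simp)]
      have h5 : (⟨j - 1, by omega⟩ : Fin n) = ⟨0, by omega⟩ := Fin.ext (by simp only []; omega)
      have h6 : j = ⟨1, by omega⟩ := Fin.ext h1
      rw [h5, h6, Equiv.swap_apply_left, Equiv.swap_apply_right, refl_comm]
      simp [swapSign]
    · rw [if_neg (by omega : ¬(j : ℕ) = 0)]
      split_ifs <;> refine refl_conj_disjoint ?_ ?_ ?_ ?_ ?_ _ _ <;>
        simp only [ne_eq, Fin.ext_iff] <;> omega

end SignedPerm

/-- **Type `Dₙ` maximal chains.**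
Let `n ≥ 4` and let `(W,S)` be a finite Coxeter system whose Coxeter matrix (indexed by
`Fin n`, with `sᵢ` corresponding to `i - 1`) is of type `Dₙ`: the order of `sᵢsᵢ₊₁` is `3`
for `2 ≤ i ≤ n−1`, the order of `s₁s₃` is `3`, and all other pairs of distinct simple
reflections commute.  Then the number of maximal chains in the noncrossing partition
lattice `L_W` is `2·(n−1)ⁿ`. -/
theorem typeD_max_chain_count
    (n : ℕ) (hn : 4 ≤ n) {W : Type} [Group W] [Fintype W]
    {M : CoxeterMatrix (Fin n)} (cs : CoxeterSystem M W)
    (hM : ∀ i j : Fin n, M i j =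
      if i = j then 1
      else if (((i : ℕ) + 1 = (j : ℕ) ∨ (j : ℕ) + 1 = (i : ℕ)) ∧ (i : ℕ) ≠ 0 ∧ (j : ℕ) ≠ 0)
          ∨ ((i : ℕ) = 0 ∧ (j : ℕ) = 2) ∨ ((j : ℕ) = 0 ∧ (i : ℕ) = 2) then 3
      else 2)
    (c : W) (hc : IsCoxeterElementOf (simpleSet cs) c) :
    maxChainCount (simpleSet cs) c n = 2 * (n - 1) ^ n := by
  obtain ⟨k, rfl⟩ : ∃ k, n = k + 2 := ⟨n - 2, by omega⟩
  have hM' : ∀ i j, M i j = SignedPerm.typeDEntry i j := hM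
  let s : ℕ → W := fun i => if h : i < k + 2 then cs.simple ⟨i, h⟩ else 1
  have hsimple : ∀ i, ∀ h : i < k + 2, s i = cs.simple ⟨i, h⟩ := fun i h => dif_pos h
  have hone : ∀ i, ¬i < k + 2 → s i = 1 := fun i h => dif_neg h
  have hsq : ∀ i, s i * s i = 1 := by
    intro i
    by_cases h : i < k + 2
    · rw [hsimple i h, cs.simple_mul_simple_self]
    · rw [hone i h, one_mul]
  have hpow : ∀ i j, ∀ hi : i < k + 2, ∀ hj : j < k + 2,
      (s i * s j) ^ SignedPerm.typeDEntry (⟨i, hi⟩ : Fin (k + 2)) ⟨j, hj⟩ = 1 := by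
    intro i j hi hj
    rw [hsimple i hi, hsimple j hj, ← hM']
    exact cs.simple_mul_simple_pow _ _
  have hs : IsTypeDSeq (k + 2) s :=
    { sq := hsq
      comm := by
        intro i j hij hj
        by_cases h : j < k + 2
        · refine mul_comm_of_mul_pow_two (hsq i) (hsq j) ?_
          rw [← hpow i j (by omega) h]
          congr 1
          simp only [SignedPerm.typeDEntry, Fin.ext_iff]
          split_ifs <;> omega
        · rw [hone j h, mul_one, one_mul]
      comm_one_zero := mul_comm_of_mul_pow_two (hsq 1) (hsq 0)
        (by simpa [SignedPerm.typeDEntry] using hpow 1 0 (by omega) (by omega))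
      braid := by
        intro i hi h
        refine braid_of_mul_pow_three (hsq i) (hsq (i + 1)) ?_
        rw [← hpow i (i + 1) (by omega) h]
        congr 1
        exact ((if_neg (by simp)).trans
          (if_pos (Or.inl ⟨Or.inl rfl, Nat.one_le_iff_ne_zero.1 hi, Nat.succ_ne_zero i⟩))).symm
      braid_zero_two := by
        intro h
        refine braid_of_mul_pow_three (hsq 0) (hsq 2) ?_
        rw [← hpow 0 2 (by omega) h]
        congr 1 }
  have hlift : M.IsLiftable (SignedPerm.typeDGen (k + 2) (by omega)) := by
    intro i j
    rw [hM' i j]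
    exact SignedPerm.typeDGen_pow _ _ i j
  have hφ : IsTypeDSeq.IsSignedRep s (cs.lift ⟨_, hlift⟩) :=
    { zero := fun h => by
        rw [hsimple 0 (by omega), cs.lift_apply_simple]
        exact if_pos rfl
      succ := fun i h => by
        rw [hsimple (i + 1) h, cs.lift_apply_simple]
        exact if_neg (Nat.succ_ne_zero i) }
  have hset : simpleSet cs = s '' {i | i < k + 2} := by
    ext x
    constructor
    · rintro ⟨i, rfl⟩
      exact ⟨i, i.2, hsimple i i.2⟩
    · rintro ⟨i, hi, rfl⟩
      exact ⟨⟨i, hi⟩, (hsimple i hi).symm⟩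
  have htop : initialSubgroup s (k + 2) = ⊤ := by
    rw [initialSubgroup, ← hset]
    exact cs.subgroup_closure_range_simple
  obtain ⟨l, hnd, hl, rfl⟩ := hc
  have hinv : ∀ x ∈ l, ∃ i < k + 2, s i = x := by
    intro x hx
    have := (hl x).1 hx
    rwa [hset] at this
  choose! r hr hsr using hinv
  have hls : (l.map r).map s = l := by
    rw [List.map_map]
    exact (List.map_congr_left fun x hx => hsr x hx).trans (List.map_id l)
  have hinj : ∀ i < k + 2, ∀ j < k + 2, s i = s j → i = j := by
    intro i hi j hj hij
    exact hφ.gen_injective (by omega) hi hj hij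
  have hperm : (l.map r).Perm (List.range (k + 2)) := by
    refine (List.perm_ext_iff_of_nodup ?_ List.nodup_range).2 fun i => ?_
    · exact List.Nodup.of_map s (by rwa [hls])
    · rw [List.mem_range]
      constructor
      · intro hi
        obtain ⟨x, hx, rfl⟩ := List.mem_map.1 hi
        exact hr x hx
      · intro hi
        have hmem : s i ∈ l := (hl _).2 (hset ▸ ⟨i, hi, rfl⟩)
        exact List.mem_map.2 ⟨s i, hmem, hinj _ (hr _ hmem) _ hi (hsr _ hmem)⟩
  rw [hset, ← hls]
  exact hφ.maxChainCount_eq hs htop _ hperm
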